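/- Let n ≥ 1, R > 0, and let B_R ⊂ ℝ^{2n} be the open ball of radius R centered at the origin. Suppose H : ℝ^{2n} → ℝ is smooth, its support is a compact subset of B_R, H is constant on some neighborhood of the origin, H(0) = max H, and max H > πR². Then the Hamiltonian flow of H has a nonconstant 1-periodic orbit γ (a nonconstant solution of γ'(t) = J∇H(γ(t)) with γ(t+1) = γ(t)) whose action A_H(γ) lies in the interval (max H, max H + πR²]. -/

import Mathlib

open scoped RealInnerProductSpace ENNReal NNReal Topology
open Metric Set

noncomputable section

/-- `ℝ^{2n}` identified with `ℂ^n`, with the standard (real) inner product and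
the standard complex structure `J` given by multiplication by `i`. -/
abbrev Esp (n : ℕ) := EuclideanSpace ℂ (Fin n)

variable {n : ℕ}

/-- The Hamiltonian vector field `X_H = J ∇H` of `H : ℝ^{2n} → ℝ`. -/
def hamVF (H : Esp n → ℝ) (x : Esp n) : Esp n := Complex.I • gradient H x

/-- A nonconstant `T`-periodic orbit of the Hamiltonian flow of `H`:
a nonconstant solution `γ` of `γ' = J∇H(γ)` with `γ (t + T) = γ t`. -/
def IsPeriodicOrbit (H : Esp n → ℝ) (γ : ℝ → Esp n) (T : ℝ) : Prop :=
  0 < T ∧ (∀ t, HasDerivAt γ (hamVF H (γ t)) t) ∧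
    (∀ t, γ (t + T) = γ t) ∧ ∃ t₀ t₁, γ t₀ ≠ γ t₁

/-- `H` has a fast (period `≤ 1`) nonconstant periodic orbit. -/
def HasFastOrbit (H : Esp n → ℝ) : Prop :=
  ∃ γ T, IsPeriodicOrbit H γ T ∧ T ≤ 1

/-- The symplectic action of a `1`-periodic loop `γ` with respect to the
(possibly time-dependent) Hamiltonian `H`:
`A_H(γ) = -(1/2)∫₀¹ ⟨Jγ(t), γ'(t)⟩ dt + ∫₀¹ H(t, γ(t)) dt`. -/
def action (H : ℝ → Esp n → ℝ) (γ : ℝ → Esp n) : ℝ :=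
  -(1 / 2) * (∫ t in (0:ℝ)..1, ⟪(Complex.I • γ t : Esp n), deriv γ t⟫) +
    ∫ t in (0:ℝ)..1, H t (γ t)

/-- The class `𝓗(V, Z)`: smooth functions on `ℝ^{2n}` with compact support
contained in `V`, constant on a neighborhood of `Z`, whose value on `Z` is the
maximum of `H`. -/
def InHclass (V Z : Set (Esp n)) (H : Esp n → ℝ) : Prop :=
  ContDiff ℝ (⊤ : ℕ∞) H ∧ IsCompact (tsupport H) ∧ tsupport H ⊆ V ∧
    (∃ U, IsOpen U ∧ Z ⊆ U ∧ ∃ c : ℝ, ∀ x ∈ U, H x = c) ∧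
    ∀ z ∈ Z, ∀ x, H x ≤ H z

/-- The relative Hofer–Zehnder capacity `c_HZ(V, Z)`: the supremum of `max H`
over all `H ∈ 𝓗(V, Z)` having no fast nonconstant periodic orbit (for `z ∈ Z`,
`H z = max H`). -/
def relCap (V Z : Set (Esp n)) : ℝ≥0∞ :=
  sSup {c | ∃ H, InHclass V Z H ∧ ¬ HasFastOrbit H ∧
    ∃ z ∈ Z, c = ENNReal.ofReal (H z)}


theorem det_interp {E : Type*} [NormedAddCommGroup E] [NormedSpace ℝ E] [FiniteDimensional ℝ E]
    (v : ℕ → ℝ) (hv : Function.Injective v) (A : E →L[ℝ] E) :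
    (1 + A).det = ∑ j ∈ Finset.range (Module.finrank ℝ E + 1), (1 + v j • A).det *
      (Lagrange.basis (Finset.range (Module.finrank ℝ E + 1)) v j).eval 1 := by
  classical
  let b := Module.finBasis ℝ E
  let M := LinearMap.toMatrix b b (A : E →ₗ[ℝ] E)
  let p : Polynomial ℝ := ((Polynomial.X : Polynomial ℝ) • M.map Polynomial.C + (1 : Matrix (Fin (Module.finrank ℝ E)) (Fin (Module.finrank ℝ E)) ℝ).map Polynomial.C).det
  have hp : ∀ t : ℝ, p.eval t = (1 + t • A).det := by
    intro t
    have h1 : p.eval t = (t • M + 1).det := by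
      simp only [p]
      rw [← Polynomial.coe_evalRingHom, RingHom.map_det]
      congr 1
      ext i j
      simp only [Matrix.one_apply, RingHom.mapMatrix_apply, Matrix.map_apply, Matrix.add_apply,
        Matrix.smul_apply, smul_eq_mul]
      split_ifs <;> simp <;> ring
    rw [h1, ContinuousLinearMap.det, ← LinearMap.det_toMatrix b]
    congr 1
    simp [M, LinearMap.toMatrix_one, add_comm]
  have hdeg : p.degree < ((Finset.range (Module.finrank ℝ E + 1)).card : ℕ) := by
    refine lt_of_le_of_lt Polynomial.degree_le_natDegree ?_
    have := Polynomial.natDegree_det_X_add_C_le M 1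
    simp only [Fintype.card_fin] at this
    simp only [Finset.card_range]
    exact_mod_cast Nat.lt_succ_of_le this
  have h := Lagrange.eq_interpolate (s := Finset.range (Module.finrank ℝ E + 1)) (v := v)
    (hv.injOn) hdeg
  have h2 := congrArg (Polynomial.eval 1) h
  rw [Lagrange.interpolate_apply, Polynomial.eval_finsetSum, hp] at h2
  simpa [hp] using h2

theorem basis_sum_one (m : ℕ) (v : ℕ → ℝ) (hv : Function.Injective v) :
    ∑ j ∈ Finset.range (m + 1), (Lagrange.basis (Finset.range (m + 1)) v j).eval 1 = 1 := by
  have h := Lagrange.sum_basis (s := Finset.range (m + 1)) (v := v) hv.injOn (by simp)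
  have h2 := congrArg (Polynomial.eval 1) h
  rwa [Polynomial.eval_finsetSum, Polynomial.eval_one] at h2

theorem det_pos_aux {E : Type*} [NormedAddCommGroup E] [NormedSpace ℝ E] [FiniteDimensional ℝ E]
    (A : E →L[ℝ] E) (h : ‖A‖ < 1) : 0 < (1 + A).det := by
  have hne : ∀ s ∈ Icc (0:ℝ) 1, (1 + s • A).det ≠ 0 := by
    intro s hs h0
    have h1 : ¬ Function.Injective ((1 + s • A : E →L[ℝ] E) : E →ₗ[ℝ] E) := by
      intro hinj
      have := LinearEquiv.isUnit_det' (LinearEquiv.ofInjectiveEndo _ hinj)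
      have h3 : LinearMap.det ((1 + s • A : E →L[ℝ] E) : E →ₗ[ℝ] E) = 0 := h0
      have h4 : ((LinearEquiv.ofInjectiveEndo _ hinj : E ≃ₗ[ℝ] E) : E →ₗ[ℝ] E)
        = ((1 + s • A : E →L[ℝ] E) : E →ₗ[ℝ] E) := by ext; simp
      rw [h4, h3] at this
      simp at this
    apply h1
    rw [injective_iff_map_eq_zero]
    intro x hx
    have hx' : x + s • A x = 0 := by simpa using hx
    by_contra hx0
    have hpos : 0 < ‖x‖ := norm_pos_iff.2 hx0
    have : ‖x‖ = ‖s • A x‖ := by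
      rw [← norm_neg (s • A x), ← eq_neg_of_add_eq_zero_left hx']
    rw [norm_smul, Real.norm_of_nonneg hs.1] at this
    have h5 := A.le_opNorm x
    nlinarith [hs.1, hs.2, norm_nonneg (A x), norm_nonneg A]
  by_contra hneg
  push Not at hneg
  have hc : ContinuousOn (fun s : ℝ => (1 + s • A).det) (Icc 0 1) := by
    apply Continuous.continuousOn
    exact ContinuousLinearMap.continuous_det.comp (by fun_prop)
  have h1 : (0:ℝ) ∈ Icc ((fun s : ℝ => (1 + s • A).det) 1) ((fun s : ℝ => (1 + s • A).det) 0) := by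
    constructor
    · simpa using hneg
    · simp [ContinuousLinearMap.det]
  obtain ⟨s, hs, hs0⟩ := intermediate_value_Icc' zero_le_one hc h1
  exact hne s hs hs0

/-- image of the ball under a small perturbation of the identity -/
theorem image_ball_aux {E : Type*} [NormedAddCommGroup E] [NormedSpace ℝ E] [FiniteDimensional ℝ E]
    [Nontrivial E] (ρ : ℝ) (hρ : 0 < ρ)
    (f : E → E) (hf : ContDiff ℝ 1 f) (hball : ∀ x ∈ closedBall (0:E) ρ, f x ∈ closedBall (0:E) ρ)
    (hsph : ∀ x ∈ sphere (0:E) ρ, f x = x)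
    (hdet : ∀ x ∈ ball (0:E) ρ, (fderiv ℝ f x).det ≠ 0) : f '' ball 0 ρ = ball 0 ρ := by
  have hopen : IsOpen (f '' ball 0 ρ) := by
    rw [isOpen_iff_mem_nhds]
    rintro _ ⟨x, hx, rfl⟩
    have hs : HasStrictFDerivAt f
        (((fderiv ℝ f x).toContinuousLinearEquivOfDetNeZero (hdet x hx) : E ≃L[ℝ] E) : E →L[ℝ] E) x := by
      have := hf.contDiffAt.hasStrictFDerivAt (x := x) (by simp)
      convert this using 1
      ext; simp
    have := hs.map_nhds_eq_of_equiv
    rw [← this]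
    exact Filter.image_mem_map (isOpen_ball.mem_nhds hx)
  have hsub : f '' ball 0 ρ ⊆ ball 0 ρ := by
    refine (interior_maximal (s := closedBall (0:E) ρ) ?_ hopen).trans
      (interior_closedBall (0:E) hρ.ne').subset
    rintro _ ⟨x, hx, rfl⟩
    exact hball x (ball_subset_closedBall hx)
  refine hsub.antisymm ?_
  refine (convex_ball (0:E) ρ).isPreconnected.subset_of_closure_inter_subset hopen ?_ ?_
  · refine ⟨f 0, hsub ⟨0, by simpa using hρ, rfl⟩, ⟨0, by simpa using hρ, rfl⟩⟩
  · rintro y ⟨hy, hyb⟩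
    have hcl : IsClosed (f '' closedBall 0 ρ) :=
      ((isCompact_closedBall (0:E) ρ).image hf.continuous).isClosed
    have : y ∈ f '' closedBall 0 ρ :=
      closure_minimal (image_mono ball_subset_closedBall) hcl hy
    obtain ⟨x, hx, rfl⟩ := this
    refine ⟨x, ?_, rfl⟩
    by_contra hxb
    have hxs : x ∈ sphere (0:E) ρ := by
      simp only [mem_sphere, mem_closedBall, mem_ball] at *
      linarith
    rw [hsph x hxs] at hyb
    exact hxb hyb

theorem no_retraction {E : Type*} [NormedAddCommGroup E] [InnerProductSpace ℝ E] [FiniteDimensional ℝ E]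
    (ρ : ℝ) (hρ : 0 < ρ) (f : E → E) (hf : ContDiff ℝ 1 f)
    (hball : ∀ x, ‖f x‖ = ρ)
    (hsph : ∀ x ∈ sphere (0:E) ρ, f x = x) : False := by
  borelize E
  have hnt : Nontrivial E := by
    refine ⟨f 0, 0, fun h => ?_⟩
    have := hball 0
    rw [h] at this
    simp at this
    linarith
  let μ : MeasureTheory.Measure E := MeasureTheory.Measure.addHaar
  let g : E → E := fun x => f x - x
  have hg : ContDiff ℝ 1 g := hf.sub contDiff_id
  have hgd : Differentiable ℝ g := hg.differentiable (by simp)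
  have hfd : Differentiable ℝ f := hf.differentiable (by simp)
  have hgc : Continuous (fderiv ℝ g) := hg.continuous_fderiv (by simp)
  obtain ⟨K0, hK0⟩ := (isCompact_closedBall (0:E) ρ).exists_bound_of_continuousOn hgc.continuousOn
  let K := max K0 1
  have hK1 : 1 ≤ K := le_max_right _ _
  have hK : ∀ x ∈ closedBall (0:E) ρ, ‖fderiv ℝ g x‖ ≤ K := fun x hx =>
    (hK0 x hx).trans (le_max_left _ _)
  have hlip : ∀ x ∈ closedBall (0:E) ρ, ∀ y ∈ closedBall (0:E) ρ, ‖g x - g y‖ ≤ K * ‖x - y‖ := by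
    intro x hx y hy
    exact (convex_closedBall (0:E) ρ).norm_image_sub_le_of_norm_fderiv_le
      (fun z _ => hgd z) hK hy hx
  have hgder : ∀ x, fderiv ℝ g x = fderiv ℝ f x - 1 := by
    intro x
    have := (hfd x).hasFDerivAt.sub (hasFDerivAt_id x)
    exact this.fderiv
  have key : ∀ t : ℝ, 0 < t → t * K < 1 →
      ∫ x in ball (0:E) ρ, (1 + t • fderiv ℝ g x).det ∂μ = (μ (ball (0:E) ρ)).toReal := by
    intro t ht htK
    have ht1 : t ≤ 1 := by nlinarith
    let F : E → E := fun x => x + t • g x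
    have hF : ContDiff ℝ 1 F := contDiff_id.add (hg.const_smul t)
    have hFd : ∀ x, HasFDerivAt F (1 + t • fderiv ℝ g x) x := fun x =>
      (hasFDerivAt_id x).add ((hgd x).hasFDerivAt.const_smul t)
    have hinj : InjOn F (closedBall 0 ρ) := by
      intro x hx y hy hxy
      by_contra hne
      have hpos : 0 < ‖x - y‖ := norm_pos_iff.2 (sub_ne_zero.2 hne)
      have h1 : x - y = - (t • (g x - g y)) := by
        have : x + t • g x = y + t • g y := hxy
        rw [smul_sub]
        rw [← sub_eq_zero] at this ⊢
        rw [← this]; abel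
      have h2 : ‖x - y‖ = t * ‖g x - g y‖ := by
        conv_lhs => rw [h1]
        rw [norm_neg, norm_smul, Real.norm_of_nonneg ht.le]
      have := hlip x hx y hy
      nlinarith
    have hdetpos : ∀ x ∈ ball (0:E) ρ, 0 < (1 + t • fderiv ℝ g x).det := by
      intro x hx
      apply det_pos_aux
      rw [norm_smul, Real.norm_of_nonneg ht.le]
      have := hK x (ball_subset_closedBall hx)
      nlinarith
    have himg : F '' ball 0 ρ = ball 0 ρ := by
      refine image_ball_aux ρ hρ F hF ?hb ?hs ?hd
      rotate_left 2
      · intro x hx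
        rw [(hFd x).fderiv]
        exact (hdetpos x hx).ne'
      · intro x hx
        have h1 : F x = (1 - t) • x + t • f x := by
          simp only [F, g]; module
        rw [mem_closedBall, dist_zero_right] at hx ⊢
        rw [h1]
        refine (norm_add_le _ _).trans ?_
        rw [norm_smul, norm_smul, hball, Real.norm_of_nonneg ht.le,
          Real.norm_of_nonneg (by linarith)]
        nlinarith
      · intro x hx
        simp [F, g, hsph x hx]
    have h := MeasureTheory.integral_image_eq_integral_abs_det_fderiv_smul μ
      (measurableSet_ball (x := (0:E)) (ε := ρ)) (fun x _ => (hFd x).hasFDerivWithinAt)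
      (hinj.mono ball_subset_closedBall) (fun _ => (1:ℝ))
    rw [himg] at h
    simp only [smul_eq_mul, mul_one, MeasureTheory.integral_const] at h
    rw [MeasureTheory.measureReal_restrict_apply_univ] at h
    rw [← MeasureTheory.measureReal_def, h]
    refine MeasureTheory.setIntegral_congr_fun measurableSet_ball ?_
    intro x hx
    exact (abs_of_pos (hdetpos x hx)).symm
  have hdet0 : ∀ x, (1 + fderiv ℝ g x).det = 0 := by
    intro x
    rw [hgder, add_sub_cancel]
    by_contra hne
    let e := (fderiv ℝ f x).toContinuousLinearEquivOfDetNeZero hne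
    have h1 : HasFDerivAt (fun y => ⟪f y, f y⟫) _ x :=
      (hfd x).hasFDerivAt.inner ℝ (hfd x).hasFDerivAt
    have h2 : (fun y => ⟪f y, f y⟫) = fun _ => ρ ^ 2 := by
      funext y; rw [real_inner_self_eq_norm_sq, hball]
    rw [h2] at h1
    have h3 := h1.unique (hasFDerivAt_const _ _)
    have h4 := congrArg (fun L : E →L[ℝ] ℝ => L (e.symm (f x))) h3
    have h5 : fderiv ℝ f x (e.symm (f x)) = f x := e.apply_symm_apply (f x)
    simp [h5, hball] at h4
    linarith
  -- nodes
  let v : ℕ → ℝ := fun j => 1 / (K + 1 + j)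
  have hv : Function.Injective v := by
    intro i j hij
    have h1 : (0:ℝ) < K + 1 + i := by positivity
    have h2 : (0:ℝ) < K + 1 + j := by positivity
    simp only [v] at hij
    rw [one_div, one_div, inv_inj] at hij
    have : (i:ℝ) = j := by linarith
    exact_mod_cast this
  have hv1 : ∀ j, 0 < v j ∧ v j * K < 1 := by
    intro j
    have h1 : (0:ℝ) < K + 1 + j := by positivity
    refine ⟨by positivity, ?_⟩
    simp only [v]
    rw [one_div, inv_mul_lt_iff₀ h1]
    have : (0:ℝ) ≤ j := by positivity
    linarith
  have hsum : ∫ x in ball (0:E) ρ, (1 + fderiv ℝ g x).det ∂μ = (μ (ball (0:E) ρ)).toReal := by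
    rw [show (fun x => (1 + fderiv ℝ g x).det) = _ from funext fun x => det_interp v hv _]
    rw [MeasureTheory.integral_finsetSum]
    · simp_rw [MeasureTheory.integral_mul_const]
      rw [Finset.sum_congr rfl (fun j _ => by rw [key (v j) (hv1 j).1 (hv1 j).2])]
      rw [← Finset.mul_sum, basis_sum_one _ v hv, mul_one]
    · intro j _
      apply MeasureTheory.Integrable.mul_const
      have hc : Continuous (fun x => (1 + v j • fderiv ℝ g x).det) :=
        ContinuousLinearMap.continuous_det.comp (by fun_prop)
      exact (hc.continuousOn.integrableOn_compact (isCompact_closedBall (0:E) ρ)).mono_set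
        ball_subset_closedBall
  simp only [hdet0, MeasureTheory.integral_zero] at hsum
  have hpos : 0 < (μ (ball (0:E) ρ)).toReal :=
    ENNReal.toReal_pos (isOpen_ball.measure_pos μ ⟨0, by simpa using hρ⟩).ne'
      MeasureTheory.measure_ball_lt_top.ne
  linarith

theorem surj_of_id_outside_euclid {E : Type*} [NormedAddCommGroup E] [InnerProductSpace ℝ E]
    [FiniteDimensional ℝ E] (F : E → E) (hF : Continuous F) (M : ℝ)
    (hid : ∀ x, M ≤ ‖x‖ → F x = x) : Function.Surjective F := by
  -- it suffices to hit zero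
  suffices h0 : ∀ (F : E → E) (_ : Continuous F) (M : ℝ) (_ : ∀ x, M ≤ ‖x‖ → F x = x), ∃ x, F x = 0 by
    intro p
    obtain ⟨x, hx⟩ := h0 (fun x => F (x + p) - p) (by fun_prop) (M + ‖p‖) (by
      intro x hx
      rw [hid (x + p) ?_]
      · abel
      · have : ‖x‖ ≤ ‖x + p‖ + ‖p‖ := by
          simpa using norm_sub_le (x + p) p
        linarith)
    exact ⟨x + p, sub_eq_zero.1 hx⟩
  clear hF hid M F
  intro F hF M hid
  by_contra hne
  push Not at hne
  let ρ := max M 1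
  have hρ : 0 < ρ := lt_max_of_lt_right one_pos
  -- distance from zero
  obtain ⟨ε, hε, hεF⟩ : ∃ ε > 0, ∀ x, ε ≤ ‖F x‖ := by
    obtain ⟨x0, -, hx0⟩ := (isCompact_closedBall (0:E) ρ).exists_isMinOn ⟨0, by simpa using hρ.le⟩
      (hF.norm.continuousOn)
    refine ⟨min ‖F x0‖ ρ, lt_min (norm_pos_iff.2 (hne x0)) hρ, fun x => ?_⟩
    by_cases hx : x ∈ closedBall (0:E) ρ
    · exact (min_le_left _ _).trans (hx0 hx)
    · have hx' : ρ < ‖x‖ := by simpa using hx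
      rw [hid x ((le_max_left _ _).trans hx'.le)]
      exact (min_le_right _ _).trans hx'.le
  obtain ⟨g, hg, hgd, hgs⟩ := (hF.sub continuous_id).exists_contDiff_approx (n := 1)
    (ε := fun _ => ε) continuous_const (fun _ => hε)
  have hmiss : ∀ x, x + g x ≠ 0 := by
    intro x hx
    have := hgd x
    rw [dist_eq_norm] at this
    have h2 : g x - (F x - x) = - F x := by
      rw [eq_neg_of_add_eq_zero_right hx]; abel
    simp only [Pi.sub_apply, id] at this
    rw [h2, norm_neg] at this
    linarith [hεF x]
  refine no_retraction ρ hρ (fun x => (ρ * ‖x + g x‖⁻¹) • (x + g x)) ?_ ?_ ?_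
  · have h1 : ContDiff ℝ 1 (fun x => x + g x) := contDiff_id.add hg
    exact ((contDiff_const).mul ((h1.norm ℝ hmiss).inv (fun x => by simpa using hmiss x))).smul h1
  · intro x
    have : ‖x + g x‖ ≠ 0 := by simpa using hmiss x
    rw [norm_smul, norm_mul, norm_inv, norm_norm, Real.norm_of_nonneg hρ.le]
    field_simp
  · intro x hx
    have hx' : ‖x‖ = ρ := by simpa using hx
    have hgx : g x = 0 := by
      by_contra h
      apply hgs h
      simp [hid x ((le_max_left _ _).trans hx'.ge)]
    simp only [hgx, add_zero, hx']
    rw [mul_inv_cancel₀ hρ.ne', one_smul]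

theorem surj_of_id_outside {E : Type*} [NormedAddCommGroup E] [NormedSpace ℝ E]
    [FiniteDimensional ℝ E] (F : E → E) (hF : Continuous F) (M : ℝ)
    (hid : ∀ x, M ≤ ‖x‖ → F x = x) : Function.Surjective F := by
  let e := toEuclidean (E := E)
  have h := surj_of_id_outside_euclid (fun y => e (F (e.symm y))) (by fun_prop)
    (‖(e : E →L[ℝ] EuclideanSpace ℝ (Fin (Module.finrank ℝ E)))‖ * M) (by
      intro y hy
      rcases lt_or_ge ‖e.symm y‖ M with h | h
      · have h1 : ‖y‖ ≤ ‖(e : E →L[ℝ] EuclideanSpace ℝ (Fin (Module.finrank ℝ E)))‖ * ‖e.symm y‖ := by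
          simpa using (e : E →L[ℝ] EuclideanSpace ℝ (Fin (Module.finrank ℝ E))).le_opNorm (e.symm y)
        rcases (norm_nonneg (e : E →L[ℝ] EuclideanSpace ℝ (Fin (Module.finrank ℝ E)))).eq_or_lt with h0 | h0
        · rw [← h0] at h1
          have hy0 : y = 0 := by
            rw [← norm_le_zero_iff]; linarith
          have hs : Subsingleton E := by
            refine ⟨fun a b => ?_⟩
            have : (e : E →L[ℝ] EuclideanSpace ℝ (Fin (Module.finrank ℝ E))) = 0 := norm_eq_zero.1 h0.symm
            apply e.injective
            have ha := congrArg (fun L => L a) this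
            have hb := congrArg (fun L => L b) this
            simp at ha hb
            simp [ha, hb]
          apply e.symm.injective
          exact Subsingleton.elim _ _
        · nlinarith
      · rw [hid _ h]; simp)
  intro p
  obtain ⟨y, hy⟩ := h (e p)
  exact ⟨e.symm y, e.injective hy⟩



/-- Discrete gradient descent deformation. -/
theorem deformation {V : Type*} [NormedAddCommGroup V] [InnerProductSpace ℝ V]
    (φ : V → ℝ) (g : V → V) (hφ : Continuous φ) (hg : Continuous g) (L : ℝ) (hL : 0 < L)
    (htay : ∀ x h, φ (x + h) ≤ φ x + ⟪g x, h⟫ + L * ‖h‖ ^ 2)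
    (α β δ : ℝ) (hα : 0 < α) (hδ : 0 < δ) (hgr : ∀ x, α ≤ φ x → φ x ≤ β → δ ≤ ‖g x‖) :
    ∃ ψ : V → V, Continuous ψ ∧ (∀ x, φ x ≤ 0 → ψ x = x) ∧ ∀ x, φ x ≤ β → φ (ψ x) < α := by
  let χ : V → ℝ := fun x => min 1 (max (φ x) 0 / α)
  have hχ0 : ∀ x, 0 ≤ χ x := fun x => le_min zero_le_one (by positivity)
  have hχ1 : ∀ x, χ x ≤ 1 := fun x => min_le_left _ _
  let η : ℝ := 1 / (2 * L)
  have hη : 0 < η := by positivity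
  have hηL : L * η = 1 / 2 := by simp only [η]; field_simp
  let S : V → V := fun x => x + (-(η * χ x)) • g x
  have hS : Continuous S := by
    simp only [S, χ]; fun_prop
  have hSdec : ∀ x, φ (S x) ≤ φ x - η / 2 * χ x * ‖g x‖ ^ 2 := by
    intro x
    refine (htay x _).trans ?_
    rw [inner_smul_right, real_inner_self_eq_norm_sq, norm_smul, norm_neg,
      Real.norm_of_nonneg (mul_nonneg hη.le (hχ0 x))]
    have h1 : L * (η * χ x * ‖g x‖) ^ 2 = (L * η) * η * χ x * χ x * ‖g x‖ ^ 2 := by ring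
    rw [h1, hηL]
    have h2 : 1 / 2 * η * χ x * χ x * ‖g x‖ ^ 2 ≤ 1 / 2 * η * χ x * 1 * ‖g x‖ ^ 2 := by
      have := hχ0 x
      have := hχ1 x
      gcongr
    linarith
  have hSle : ∀ x, φ (S x) ≤ φ x := fun x => (hSdec x).trans (by
    have := hχ0 x
    have : 0 ≤ η / 2 * χ x * ‖g x‖ ^ 2 := by positivity
    linarith)
  have hSid : ∀ x, φ x ≤ 0 → S x = x := by
    intro x hx
    simp [S, χ, max_eq_right hx]
  have hstep : ∀ x, φ x ≤ β → α ≤ φ x → φ (S x) ≤ φ x - η / 2 * δ ^ 2 := by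
    intro x hx hx2
    have h1 : χ x = 1 := by
      simp only [χ]
      rw [max_eq_left (by linarith), min_eq_left]
      rw [le_div_iff₀ hα]; linarith
    refine (hSdec x).trans ?_
    rw [h1, mul_one]
    have := hgr x hx2 hx
    gcongr
  have hiter : ∀ (k : ℕ) x, φ x ≤ β → φ (S^[k] x) < α ∨ φ (S^[k] x) ≤ β - k * (η / 2 * δ ^ 2) := by
    intro k
    induction k with
    | zero => intro x hx; right; simpa using hx
    | succ k ih =>
      intro x hx
      rw [Function.iterate_succ_apply']
      rcases ih x hx with h | h
      · left; exact (hSle _).trans_lt h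
      · by_cases h2 : φ (S^[k] x) < α
        · left; exact (hSle _).trans_lt h2
        · right
          have : 0 ≤ k * (η / 2 * δ ^ 2) := by positivity
          have := hstep (S^[k] x) (by linarith) (not_lt.1 h2)
          push_cast
          linarith
  obtain ⟨k, hk⟩ := exists_nat_gt ((β - α) / (η / 2 * δ ^ 2))
  refine ⟨S^[k], hS.iterate k, fun x hx => ?_, fun x hx => ?_⟩
  · exact Function.iterate_fixed (hSid x hx) k
  · rcases hiter k x hx with h | h
    · exact h
    · rw [div_lt_iff₀ (by positivity)] at hk
      linarith

theorem linking {V : Type*} [NormedAddCommGroup V] [InnerProductSpace ℝ V]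
    {W : Type*} [NormedAddCommGroup W] [NormedSpace ℝ W] [FiniteDimensional ℝ W]
    (φ : V → ℝ) (g : V → V) (hφ : Continuous φ) (hg : Continuous g) (L : ℝ) (hL : 0 < L)
    (htay : ∀ x h, φ (x + h) ≤ φ x + ⟪g x, h⟫ + L * ‖h‖ ^ 2)
    (i : W → V) (hi : Continuous i) (P : V → W) (hP : Continuous P) (e : V)
    (hPi : ∀ w (s : ℝ), P (i w + s • e) = w)
    (q : V → ℝ) (hq : Continuous q) (hqi : ∀ w (s : ℝ), q (i w + s • e) = |s|)
    (α β δ ρ M : ℝ) (hα : 0 < α) (hδ : 0 < δ) (hρ : 0 < ρ)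
    (hβ : ∀ w (s : ℝ), φ (i w + s • e) ≤ β)
    (h0 : ∀ w, φ (i w) ≤ 0)
    (hM : ∀ w (s : ℝ), M ≤ ‖w‖ ∨ M ≤ |s| → φ (i w + s • e) ≤ 0)
    (hsph : ∀ x, P x = 0 → q x = ρ → α ≤ φ x) :
    ∃ x, α ≤ φ x ∧ φ x ≤ β ∧ ‖g x‖ < δ := by
  by_contra hcon
  push Not at hcon
  obtain ⟨ψ, hψ, hid, hlow⟩ := deformation φ g hφ hg L hL htay α β δ hα hδ hcon
  let F : W × ℝ → W × ℝ := fun z =>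
    (P (ψ (i z.1 + (max z.2 0) • e)), q (ψ (i z.1 + (max z.2 0) • e)) + min z.2 0)
  have hF : Continuous F := by simp only [F]; fun_prop
  have hF0 : ∀ z : W × ℝ, φ (i z.1 + (max z.2 0) • e) ≤ 0 → F z = z := by
    intro z hz
    simp only [F]
    rw [hid _ hz, hPi, hqi]
    ext
    · rfl
    · simp only
      rw [abs_of_nonneg (le_max_right _ _), max_add_min, add_zero]
  have hFneg : ∀ z : W × ℝ, z.2 ≤ 0 → F z = z := by
    intro z hz
    apply hF0
    rw [max_eq_right hz]
    simpa using h0 z.1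
  have hsurj := surj_of_id_outside F hF M (by
    intro z hz
    rcases le_total z.2 0 with h | h
    · exact hFneg z h
    · apply hF0
      rw [max_eq_left h]
      apply hM
      rw [Prod.norm_def] at hz
      rcases le_max_iff.1 hz with h | h
      · left; exact h
      · right; simpa using h)
  obtain ⟨z, hz⟩ := hsurj (0, ρ)
  rcases le_total z.2 0 with h | h
  · rw [hFneg z h] at hz
    rw [hz] at h
    simp only at h
    linarith
  · have h1 := congrArg Prod.fst hz
    have h2 := congrArg Prod.snd hz
    simp only [F, max_eq_left h, min_eq_right h, add_zero] at h1 h2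
    have := hsph _ h1 h2
    have := hlow _ (hβ z.1 z.2)
    linarith




theorem Esp.inner_re (x y : Esp n) : ⟪x, y⟫ = (inner ℂ x y : ℂ).re := by
  simp [PiLp.inner_apply, Complex.inner]

theorem Esp.inner_conj_smul (a : ℂ) (x y : Esp n) :
    ⟪(starRingEnd ℂ a) • x, y⟫ = ⟪x, a • y⟫ := by
  rw [Esp.inner_re, Esp.inner_re, inner_smul_left, inner_smul_right, Complex.conj_conj]

theorem Esp.inner_I_smul (x y : Esp n) :
    ⟪Complex.I • x, Complex.I • y⟫ = ⟪x, y⟫ := by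
  rw [← Esp.inner_conj_smul, smul_smul]; simp

/-- The exponentials. -/
def ex (k : ℤ) (t : ℝ) : ℂ := Complex.exp (-(2 * Real.pi * k * t : ℝ) * Complex.I)

theorem ex_norm (k : ℤ) (t : ℝ) : ‖ex k t‖ = 1 := by
  rw [ex, ← Complex.ofReal_neg, Complex.norm_exp_ofReal_mul_I]

@[fun_prop]
theorem ex_cont (k : ℤ) : Continuous (ex k) := by
  unfold ex; fun_prop

theorem ex_conj (k : ℤ) (t : ℝ) : (starRingEnd ℂ) (ex k t) = ex (-k) t := by
  rw [ex, ex, ← Complex.exp_conj]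
  congr 1
  rw [map_mul, map_neg, Complex.conj_ofReal, Complex.conj_I]
  push_cast; ring

theorem ex_mul (k l : ℤ) (t : ℝ) : ex k t * ex l t = ex (k + l) t := by
  rw [ex, ex, ex, ← Complex.exp_add]
  congr 1
  push_cast; ring

theorem ex_zero (t : ℝ) : ex 0 t = 1 := by simp [ex]

theorem ex_eq_fourier (k : ℤ) (t : ℝ) : ex k t = fourier (-k) (t : AddCircle (1:ℝ)) := by
  rw [fourier_coe_apply, ex]
  congr 1
  push_cast; ring

theorem ex_per (k : ℤ) (t : ℝ) : ex k (t + 1) = ex k t := by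
  rw [ex_eq_fourier, ex_eq_fourier]
  congr 1
  exact AddCircle.coe_add_period _ _

theorem ex_int (k : ℤ) : ∫ t in (0:ℝ)..1, ex k t = if k = 0 then 1 else 0 := by
  split_ifs with h
  · simp [h, ex_zero]
  · have h1 : (-(2 * Real.pi * k) * Complex.I : ℂ) ≠ 0 := by
      simp [h, Real.pi_ne_zero]
    have h2 : ∀ t : ℝ, ex k t = Complex.exp ((-(2 * Real.pi * k) * Complex.I) * t) := by
      intro t; rw [ex]; congr 1; push_cast; ring
    simp_rw [h2]
    rw [integral_exp_mul_complex h1]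
    have h3 : Complex.exp (-(2 * Real.pi * k) * Complex.I * (1:ℝ)) = 1 := by
      rw [Complex.exp_eq_one_iff]
      exact ⟨-k, by push_cast; ring⟩
    rw [h3]; simp

/-- Fourier coefficients. -/
def co (f : ℝ → Esp n) (k : ℤ) : Esp n := ∫ t in (0:ℝ)..1, ex (-k) t • f t

abbrev Ix (N : ℕ) := ↥(Finset.Icc (-(N:ℤ)) (N:ℤ))
abbrev VV (n N : ℕ) := PiLp 2 (fun _ : Ix N => Esp n)

def tp {N : ℕ} (c : VV n N) (t : ℝ) : Esp n := ∑ k : Ix N, ex k t • c k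

@[fun_prop]
theorem tp_cont {N : ℕ} (c : VV n N) : Continuous (tp c) := by
  unfold tp; fun_prop

theorem tp_cont2 {N : ℕ} : Continuous (fun p : VV n N × ℝ => tp p.1 p.2) := by
  unfold tp
  refine continuous_finsetSum _ fun k _ => ?_
  exact ((ex_cont k).comp continuous_snd).smul (by fun_prop)

theorem tp_add {N : ℕ} (c d : VV n N) (t : ℝ) : tp (c + d) t = tp c t + tp d t := by
  simp [tp, smul_add, Finset.sum_add_distrib]

def coV (N : ℕ) (f : ℝ → Esp n) : VV n N := WithLp.toLp 2 (fun k : Ix N => co f k)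

theorem inner_coV {N : ℕ} (f : ℝ → Esp n) (hf : Continuous f) (h : VV n N) :
    ⟪coV N f, h⟫ = ∫ t in (0:ℝ)..1, ⟪f t, tp h t⟫ := by
  have h1 : ∀ k : Ix N, ⟪co f k, h k⟫ = ∫ t in (0:ℝ)..1, ⟪f t, ex k t • h k⟫ := by
    intro k
    have h2 : ⟪co f k, h k⟫ = innerSL ℝ (h k) (co f k) := by
      rw [innerSL_apply_apply, real_inner_comm]
    rw [h2, co, ← ContinuousLinearMap.intervalIntegral_comp_comm]
    · refine intervalIntegral.integral_congr fun t _ => ?_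
      simp only [innerSL_apply_apply]
      rw [real_inner_comm, ← ex_conj, Esp.inner_conj_smul]
    · apply Continuous.intervalIntegrable
      fun_prop
  rw [PiLp.inner_apply]
  simp_rw [coV, h1, tp, inner_sum]
  rw [intervalIntegral.integral_finsetSum]
  intro k _
  apply Continuous.intervalIntegrable
  fun_prop

theorem co_tp {N : ℕ} (c : VV n N) (k : Ix N) : co (tp c) k = c k := by
  unfold co tp
  simp_rw [Finset.smul_sum, smul_smul, ex_mul]
  rw [intervalIntegral.integral_finsetSum]
  · simp_rw [intervalIntegral.integral_smul_const, ex_int]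
    rw [Finset.sum_eq_single k]
    · simp
    · intro b _ hb
      rw [if_neg, zero_smul]
      intro h
      apply hb
      ext
      linarith
    · simp
  · intro l _
    apply Continuous.intervalIntegrable
    fun_prop

theorem parseval {N : ℕ} (c h : VV n N) :
    ∫ t in (0:ℝ)..1, ⟪tp c t, tp h t⟫ = ⟪c, h⟫ := by
  rw [← inner_coV _ (tp_cont c)]
  congr 1
  ext1 k
  exact co_tp c k

theorem parseval_sq {N : ℕ} (c : VV n N) :
    ∫ t in (0:ℝ)..1, ‖tp c t‖ ^ 2 = ‖c‖ ^ 2 := by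
  simp_rw [← real_inner_self_eq_norm_sq]
  exact parseval c c




def phiN (N : ℕ) (G : Esp n → ℝ) (c : VV n N) : ℝ :=
  ∑ k : Ix N, Real.pi * (k:ℤ) * ‖c k‖ ^ 2 - ∫ t in (0:ℝ)..1, G (tp c t)

def gradN (N : ℕ) (G' : Esp n → Esp n) (c : VV n N) : VV n N :=
  WithLp.toLp 2 (fun k : Ix N => (2 * Real.pi * (k:ℤ) : ℝ) • c k) - coV N (fun t => G' (tp c t))

theorem phiN_cont (N : ℕ) (G : Esp n → ℝ) (hG : Continuous G) : Continuous (phiN N G) := by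
  unfold phiN
  apply Continuous.sub
  · fun_prop
  · apply intervalIntegral.continuous_parametric_intervalIntegral_of_continuous'
    exact hG.comp tp_cont2

theorem gradN_cont (N : ℕ) (G' : Esp n → Esp n) (hG' : Continuous G') :
    Continuous (gradN N G') := by
  unfold gradN
  apply Continuous.sub
  · fun_prop
  · unfold coV
    refine (PiLp.continuous_toLp 2 _).comp ?_
    refine continuous_pi fun k => ?_
    unfold co
    apply intervalIntegral.continuous_parametric_intervalIntegral_of_continuous'
    exact ((ex_cont _).comp continuous_snd).smul (hG'.comp tp_cont2)

theorem phiN_taylor (N : ℕ) (G : Esp n → ℝ) (G' : Esp n → Esp n) (hG : Continuous G)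
    (hG' : Continuous G') (L : ℝ)
    (htay : ∀ z w, G z + ⟪G' z, w⟫ - L * ‖w‖ ^ 2 ≤ G (z + w)) (c h : VV n N) :
    phiN N G (c + h) ≤ phiN N G c + ⟪gradN N G' c, h⟫ + (Real.pi * N + L) * ‖h‖ ^ 2 := by
  have h1 : ∫ t in (0:ℝ)..1, (G (tp c t) + ⟪G' (tp c t), tp h t⟫ - L * ‖tp h t‖ ^ 2) ≤
      ∫ t in (0:ℝ)..1, G (tp (c + h) t) := by
    apply intervalIntegral.integral_mono_on zero_le_one
    · apply Continuous.intervalIntegrable; fun_prop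
    · apply Continuous.intervalIntegrable; fun_prop
    · intro t _
      rw [tp_add]
      exact htay _ _
  rw [intervalIntegral.integral_sub (by apply Continuous.intervalIntegrable; fun_prop)
      (by apply Continuous.intervalIntegrable; fun_prop),
    intervalIntegral.integral_add (by apply Continuous.intervalIntegrable; fun_prop)
      (by apply Continuous.intervalIntegrable; fun_prop),
    intervalIntegral.integral_const_mul, parseval_sq] at h1
  unfold phiN gradN
  rw [inner_sub_left, inner_coV _ (by fun_prop)]
  have h2 : ∑ k : Ix N, Real.pi * (k:ℤ) * ‖(c + h) k‖ ^ 2 ≤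
      ∑ k : Ix N, Real.pi * (k:ℤ) * ‖c k‖ ^ 2 +
      ⟪(WithLp.toLp 2 (fun k : Ix N => (2 * Real.pi * (k:ℤ) : ℝ) • c k) : VV n N), h⟫ +
      Real.pi * N * ‖h‖ ^ 2 := by
    rw [PiLp.inner_apply, PiLp.norm_sq_eq_of_L2, Finset.mul_sum, ← Finset.sum_add_distrib,
      ← Finset.sum_add_distrib]
    refine Finset.sum_le_sum fun k _ => ?_
    simp only [PiLp.add_apply]
    rw [norm_add_sq_real, real_inner_smul_left]
    have h3 : ((k:ℤ):ℝ) ≤ N := by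
      have := (Finset.mem_Icc.1 k.2).2
      exact_mod_cast this
    have h4 : Real.pi * (k:ℤ) * ‖h k‖ ^ 2 ≤ Real.pi * N * ‖h k‖ ^ 2 := by
      have := Real.pi_pos
      gcongr
    linarith
  linarith

theorem sphere_est (N : ℕ) (G : Esp n → ℝ) (hG : Continuous G) (C r : ℝ)
    (hC : 0 < C) (hr : 0 < r) (hGr : ∀ z, ‖z‖ ≤ r → G z = 0) (hGC : ∀ z, G z ≤ C * ‖z‖ ^ 2)
    (m : ℕ) (hm : 8 * C ≤ Real.pi * m) (ρ : ℝ) (hρ : 0 < ρ) (hρr : m * ρ ≤ r / 2)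
    (x : VV n N) (hx0 : ∀ k : Ix N, (k:ℤ) ≤ 0 → x k = 0)
    (hxρ : ∑ k : Ix N, ((k:ℤ):ℝ) * ‖x k‖ ^ 2 = ρ ^ 2) :
    Real.pi * ρ ^ 2 / 2 ≤ phiN N G x := by
  have hnn : ∀ k : Ix N, 0 ≤ ((k:ℤ):ℝ) * ‖x k‖ ^ 2 := by
    intro k
    rcases le_or_gt (k:ℤ) 0 with h | h
    · rw [hx0 k h]; simp
    · have : (0:ℝ) ≤ ((k:ℤ):ℝ) := by exact_mod_cast h.le
      positivity
  have hm0 : (0:ℝ) < m := by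
    by_contra h
    have := Real.pi_pos
    nlinarith
  let y : VV n N := WithLp.toLp 2 (fun k : Ix N => if (k:ℤ) ≤ m then x k else 0)
  let w : VV n N := WithLp.toLp 2 (fun k : Ix N => if (k:ℤ) ≤ m then 0 else x k)
  have hyw : x = y + w := by
    ext1 k
    simp only [y, w, PiLp.add_apply]
    split_ifs <;> simp
  have hy : ∀ t, ‖tp y t‖ ≤ r / 2 := by
    intro t
    refine le_trans ?_ hρr
    unfold tp
    refine (norm_sum_le _ _).trans ?_
    have h1 : ∀ k : Ix N, ‖ex k t • y k‖ ≤ if (k:ℤ) ∈ Finset.Icc (1:ℤ) m then ρ else 0 := by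
      intro k
      rw [norm_smul, ex_norm, one_mul]
      simp only [y, Finset.mem_Icc]
      rcases le_or_gt (k:ℤ) 0 with h | h
      · rw [hx0 k h]
        simp only [ite_self, norm_zero]
        split_ifs <;> linarith
      · by_cases h2 : (k:ℤ) ≤ m
        · rw [if_pos h2, if_pos ⟨by omega, h2⟩]
          refine (sq_le_sq₀ (norm_nonneg _) hρ.le).1 ?_
          rw [← hxρ]
          have h3 : (1:ℝ) ≤ ((k:ℤ):ℝ) := by exact_mod_cast h
          calc ‖x k‖ ^ 2 ≤ ((k:ℤ):ℝ) * ‖x k‖ ^ 2 := by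
                have := sq_nonneg ‖x k‖
                nlinarith
            _ ≤ _ := Finset.single_le_sum (f := fun k : Ix N => ((k:ℤ):ℝ) * ‖x k‖ ^ 2)
                (fun k _ => hnn k) (Finset.mem_univ k)
        · rw [if_neg h2, if_neg (fun h => h2 h.2)]; simp
    refine (Finset.sum_le_sum fun k _ => h1 k).trans ?_
    rw [← Finset.sum_filter, Finset.sum_const, nsmul_eq_mul]
    gcongr
    calc (Finset.univ.filter (fun k : Ix N => (k:ℤ) ∈ Finset.Icc (1:ℤ) m)).card
        ≤ (Finset.Icc (1:ℤ) m).card := by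
          refine Finset.card_le_card_of_injOn (fun k => (k:ℤ)) ?_ ?_
          · intro k hk
            simpa using hk
          · intro a _ b _ h
            exact Subtype.ext h
      _ = m := by simp
  have hpt : ∀ t, G (tp x t) ≤ 4 * C * ‖tp w t‖ ^ 2 := by
    intro t
    rw [hyw, tp_add]
    by_cases h : ‖tp y t + tp w t‖ ≤ r
    · rw [hGr _ h]; positivity
    · push Not at h
      have h1 := norm_add_le (tp y t) (tp w t)
      have h2 := hy t
      have h3 : ‖tp y t + tp w t‖ ≤ 2 * ‖tp w t‖ := by linarith
      calc G _ ≤ C * ‖tp y t + tp w t‖ ^ 2 := hGC _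
        _ ≤ C * (2 * ‖tp w t‖) ^ 2 := by gcongr
        _ = _ := by ring
  have hw : m * ‖w‖ ^ 2 ≤ ρ ^ 2 := by
    rw [← hxρ, PiLp.norm_sq_eq_of_L2, Finset.mul_sum]
    refine Finset.sum_le_sum fun k _ => ?_
    simp only [w]
    split_ifs with h
    · simpa using hnn k
    · have : (m:ℝ) ≤ ((k:ℤ):ℝ) := by exact_mod_cast (not_le.1 h).le
      gcongr
  have hIntG : ∫ t in (0:ℝ)..1, G (tp x t) ≤ 4 * C * ‖w‖ ^ 2 := by
    rw [← parseval_sq, ← intervalIntegral.integral_const_mul]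
    apply intervalIntegral.integral_mono_on zero_le_one
    · apply Continuous.intervalIntegrable; fun_prop
    · apply Continuous.intervalIntegrable; fun_prop
    · intro t _
      exact hpt t
  unfold phiN
  simp_rw [mul_assoc Real.pi]
  rw [← Finset.mul_sum, hxρ]
  have h5 : 8 * C * ‖w‖ ^ 2 ≤ Real.pi * (m * ‖w‖ ^ 2) := by
    rw [← mul_assoc]; gcongr
  have h6 : Real.pi * (m * ‖w‖ ^ 2) ≤ Real.pi * ρ ^ 2 := by
    have := Real.pi_pos
    gcongr
  linarith

theorem galerkin (hn : 1 ≤ n) (G : Esp n → ℝ) (G' : Esp n → Esp n) (hG : Continuous G)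
    (hG' : Continuous G') (L : ℝ) (hL : 0 ≤ L)
    (htay : ∀ z w, G z + ⟪G' z, w⟫ - L * ‖w‖ ^ 2 ≤ G (z + w))
    (C r R : ℝ) (hC : 0 < C) (hr : 0 < r) (hG0 : ∀ z, 0 ≤ G z)
    (hGr : ∀ z, ‖z‖ ≤ r → G z = 0) (hGC : ∀ z, G z ≤ C * ‖z‖ ^ 2)
    (hGR : ∀ z, Real.pi * ‖z‖ ^ 2 - Real.pi * R ^ 2 ≤ G z)
    (hGinf : ∀ z, 3 * Real.pi / 2 * ‖z‖ ^ 2 - C ≤ G z) :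
    ∃ α > 0, ∀ N : ℕ, 1 ≤ N → ∀ δ > 0, ∃ c : VV n N, α ≤ phiN N G c ∧
      phiN N G c ≤ Real.pi * R ^ 2 ∧ ‖gradN N G' c‖ < δ := by
  have hpi := Real.pi_pos
  obtain ⟨m, hm⟩ := exists_nat_gt (8 * C / Real.pi)
  have hm0 : (0:ℝ) < m := lt_trans (by positivity) hm
  have hm' : 8 * C ≤ Real.pi * m := by
    rw [div_lt_iff₀ hpi] at hm; linarith
  let ρ := r / (2 * m)
  have hρ : 0 < ρ := by positivity
  have hρr : m * ρ ≤ r / 2 := by simp only [ρ]; field_simp; rfl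
  refine ⟨Real.pi * ρ ^ 2 / 2, by positivity, fun N hN δ hδ => ?_⟩
  let one : Ix N := ⟨1, by rw [Finset.mem_Icc]; omega⟩
  let u : Esp n := EuclideanSpace.single ⟨0, hn⟩ (1:ℂ)
  have hu : ‖u‖ = 1 := by simp [u]
  let e : VV n N := WithLp.toLp 2 (fun k : Ix N => if (k:ℤ) = 1 then u else 0)
  let i : ({k : Ix N // (k:ℤ) ≤ 0} → Esp n) → VV n N := fun w =>
    WithLp.toLp 2 (fun k : Ix N => if h : (k:ℤ) ≤ 0 then w ⟨k, h⟩ else 0)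
  let P : VV n N → ({k : Ix N // (k:ℤ) ≤ 0} → Esp n) := fun x k => x k.1
  let q : VV n N → ℝ := fun x => √ (∑ k : Ix N, if 0 < (k:ℤ) then ((k:ℤ):ℝ) * ‖x k‖ ^ 2 else 0)
  have hval : ∀ w (s : ℝ) (k : Ix N), (i w + s • e) k =
      if h : (k:ℤ) ≤ 0 then w ⟨k, h⟩ else if (k:ℤ) = 1 then s • u else 0 := by
    intro w s k
    simp only [i, e, PiLp.add_apply, PiLp.smul_apply]
    split_ifs with h1 h2
    · omega
    · simp
    · simp
    · simp
  have hquad : ∀ w (s : ℝ), phiN N G (i w + s • e) ≤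
      Real.pi * ‖i w + s • e‖ ^ 2 - ∫ t in (0:ℝ)..1, G (tp (i w + s • e) t) := by
    intro w s
    unfold phiN
    gcongr
    rw [PiLp.norm_sq_eq_of_L2, Finset.mul_sum]
    refine Finset.sum_le_sum fun k _ => ?_
    rw [mul_assoc]
    gcongr
    rcases le_or_gt (k:ℤ) 1 with h | h
    · have : ((k:ℤ):ℝ) ≤ 1 := by exact_mod_cast h
      have := sq_nonneg ‖(i w + s • e) k‖
      nlinarith
    · rw [hval, dif_neg (by omega), if_neg (by omega)]; simp
  have hIntG : ∀ (a b : ℝ) (_ : ∀ z, a * ‖z‖ ^ 2 - b ≤ G z) (x : VV n N),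
      a * ‖x‖ ^ 2 - b ≤ ∫ t in (0:ℝ)..1, G (tp x t) := by
    intro a b hab x
    have h1 : ∫ t in (0:ℝ)..1, (a * ‖tp x t‖ ^ 2 - b) ≤ ∫ t in (0:ℝ)..1, G (tp x t) := by
      apply intervalIntegral.integral_mono_on zero_le_one
      · apply Continuous.intervalIntegrable; fun_prop
      · apply Continuous.intervalIntegrable; fun_prop
      · intro t _; exact hab _
    rw [intervalIntegral.integral_sub (by apply Continuous.intervalIntegrable; fun_prop)
      (by apply Continuous.intervalIntegrable; fun_prop),
      intervalIntegral.integral_const_mul, parseval_sq] at h1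
    simpa using h1
  refine linking (phiN N G) (gradN N G') (phiN_cont N G hG) (gradN_cont N G' hG')
    (Real.pi * N + L) (by positivity) (phiN_taylor N G G' hG hG' L htay) i ?_ P ?_ e ?_ q ?_ ?_
    (Real.pi * ρ ^ 2 / 2) (Real.pi * R ^ 2) δ ρ (2 * C / Real.pi + 1) (by positivity) hδ hρ ?_ ?_ ?_ ?_
  · refine (PiLp.continuous_toLp 2 _).comp (continuous_pi fun k => ?_)
    by_cases h : (k:ℤ) ≤ 0
    · simp only [h, dif_pos]; fun_prop
    · simp only [h, dif_neg, not_false_eq_true]; fun_prop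
  · simp only [P]; fun_prop
  · intro w s
    ext1 k
    simp only [P]
    rw [hval, dif_pos k.2]
  · simp only [q]
    refine Continuous.sqrt (continuous_finsetSum _ fun k _ => ?_)
    split_ifs <;> fun_prop
  · intro w s
    simp only [q]
    rw [← Real.sqrt_sq_eq_abs]
    congr 1
    rw [Finset.sum_eq_single one]
    · rw [hval]; simp [one, norm_smul, hu]
    · intro k _ hk
      have hk1 : (k:ℤ) ≠ 1 := fun h => hk (Subtype.ext h)
      split_ifs with h
      · rw [hval, dif_neg (by omega), if_neg hk1]; simp
      · rfl
    · simp
  · intro w s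
    have h1 := hIntG Real.pi (Real.pi * R ^ 2) hGR (i w + s • e)
    linarith [hquad w s]
  · intro w
    unfold phiN
    have h1 : 0 ≤ ∫ t in (0:ℝ)..1, G (tp (i w) t) :=
      intervalIntegral.integral_nonneg zero_le_one fun t _ => hG0 _
    have h2 : ∑ k : Ix N, Real.pi * (k:ℤ) * ‖i w k‖ ^ 2 ≤ 0 := by
      refine Finset.sum_nonpos fun k _ => ?_
      rcases le_or_gt (k:ℤ) 0 with h | h
      · have : ((k:ℤ):ℝ) ≤ 0 := by exact_mod_cast h
        rw [mul_assoc]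
        exact mul_nonpos_of_nonneg_of_nonpos hpi.le
          (mul_nonpos_of_nonpos_of_nonneg this (sq_nonneg _))
      · simp only [i, dif_neg (not_le.2 h)]; simp
    linarith
  · intro w s hM
    have h1 := hIntG (3 * Real.pi / 2) C hGinf (i w + s • e)
    have h2 := hquad w s
    have h3 : 2 * C / Real.pi + 1 ≤ ‖i w + s • e‖ := by
      rcases hM with h | h
      · refine h.trans ?_
        rw [pi_norm_le_iff_of_nonneg (norm_nonneg _)]
        intro k
        have := PiLp.norm_apply_le (i w + s • e) k.1
        rwa [hval, dif_pos k.2] at this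
      · refine h.trans ?_
        have := PiLp.norm_apply_le (i w + s • e) one
        rw [hval] at this
        simpa [one, norm_smul, hu] using this
    have h4 : 2 * C / Real.pi + 1 ≤ ‖i w + s • e‖ ^ 2 := by
      have : 0 ≤ 2 * C / Real.pi := by positivity
      nlinarith
    have h5 : Real.pi * (2 * C / Real.pi + 1) ≤ Real.pi * ‖i w + s • e‖ ^ 2 := by gcongr
    rw [mul_add, mul_div_cancel₀ _ hpi.ne'] at h5
    linarith
  · intro x hPx hqx
    have hx0 : ∀ k : Ix N, (k:ℤ) ≤ 0 → x k = 0 := fun k hk => congrFun hPx ⟨k, hk⟩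
    refine sphere_est N G hG C r hC hr hGr hGC m hm' ρ hρ hρr x hx0 ?_
    simp only [q] at hqx
    rw [← hqx, Real.sq_sqrt]
    · refine Finset.sum_congr rfl fun k _ => ?_
      split_ifs with h
      · rfl
      · rw [hx0 k (not_lt.1 h)]; simp
    · refine Finset.sum_nonneg fun k _ => ?_
      split_ifs with h
      · have : (0:ℝ) ≤ ((k:ℤ):ℝ) := by exact_mod_cast h.le
        positivity
      · rfl




theorem wsum : Summable (fun k : ℤ => 1 / (1 + |(k:ℝ)|) ^ 2) := by
  have h1 : Summable (fun k : ℕ => 1 / (1 + |((k:ℤ):ℝ)|) ^ 2) := by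
    have := (summable_nat_add_iff 1).2 (Real.summable_one_div_nat_pow (p := 2) |>.2 (by norm_num))
    refine this.congr fun k => ?_
    simp [add_comm]
  refine Summable.of_nat_of_neg h1 ?_
  refine h1.congr fun k => ?_
  simp

theorem young_w (e : ℝ) (he : 0 < e) (d : ℤ → Esp n) (B : ℝ) (s : Finset ℤ)
    (h : ∑ k ∈ s, (1 + |(k:ℝ)|) ^ 2 * ‖d k‖ ^ 2 ≤ B) :
    ∑ k ∈ s, ‖d k‖ ≤ e * B + (∑ k ∈ s, 1 / (1 + |(k:ℝ)|) ^ 2) / e := by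
  have h1 : ∀ k ∈ s, ‖d k‖ ≤ e * ((1 + |(k:ℝ)|) ^ 2 * ‖d k‖ ^ 2) +
      (1 / (1 + |(k:ℝ)|) ^ 2) / e := by
    intro k _
    have hw : 0 < 1 + |(k:ℝ)| := by positivity
    set w := 1 + |(k:ℝ)|
    have h2 : (1 / w ^ 2) / e = e * (1 / (w * e)) ^ 2 := by field_simp
    have h3 : ‖d k‖ = e * ((w * ‖d k‖) * (1 / (w * e))) := by field_simp
    rw [h2]
    have h4 : (w * ‖d k‖) * (1 / (w * e)) ≤ (w ^ 2 * ‖d k‖ ^ 2) + (1 / (w * e)) ^ 2 := by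
      nlinarith [sq_nonneg (w * ‖d k‖ - 1 / (w * e)), sq_nonneg (w * ‖d k‖ ),
        sq_nonneg (1 / (w * e))]
    calc ‖d k‖ = e * ((w * ‖d k‖) * (1 / (w * e))) := h3
      _ ≤ e * ((w ^ 2 * ‖d k‖ ^ 2) + (1 / (w * e)) ^ 2) := by gcongr
      _ = _ := by ring
  calc _ ≤ _ := Finset.sum_le_sum h1
    _ = e * ∑ k ∈ s, (1 + |(k:ℝ)|) ^ 2 * ‖d k‖ ^ 2 +
      (∑ k ∈ s, 1 / (1 + |(k:ℝ)|) ^ 2) / e := by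
        rw [Finset.sum_add_distrib, Finset.mul_sum, Finset.sum_div]
    _ ≤ _ := by gcongr

theorem seq_compact (u : ℕ → ℤ → Esp n) (B : ℝ)
    (h : ∀ N, ∀ s : Finset ℤ, ∑ k ∈ s, (1 + |(k:ℝ)|) ^ 2 * ‖u N k‖ ^ 2 ≤ B) :
    ∃ (c : ℤ → Esp n) (φ : ℕ → ℕ), StrictMono φ ∧
      (∀ k, Filter.Tendsto (fun j => u (φ j) k) Filter.atTop (𝓝 (c k))) ∧
      Summable (fun k => ‖c k‖) ∧
      ∀ e > 0, ∀ᶠ j in Filter.atTop, ∀ s : Finset ℤ, ∑ k ∈ s, ‖u (φ j) k - c k‖ ≤ e := by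
  have hB : 0 ≤ B := by simpa using h 0 ∅
  have hK : IsCompact (Set.pi univ (fun _ : ℤ => closedBall (0 : Esp n) (B + 1))) :=
    isCompact_univ_pi fun _ => isCompact_closedBall _ _
  have hu : ∀ N, u N ∈ Set.pi univ (fun _ : ℤ => closedBall (0 : Esp n) (B + 1)) := by
    intro N k _
    rw [mem_closedBall, dist_zero_right]
    have h1 := h N {k}
    rw [Finset.sum_singleton] at h1
    have h2 : (1:ℝ) ≤ (1 + |(k:ℝ)|) ^ 2 := by
      have := abs_nonneg (k:ℝ); nlinarith
    have h3 : ‖u N k‖ ^ 2 ≤ B := by nlinarith [sq_nonneg ‖u N k‖]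
    nlinarith [norm_nonneg (u N k)]
  obtain ⟨c, -, φ, hφ, hc⟩ := hK.isSeqCompact hu
  have hck : ∀ k, Filter.Tendsto (fun j => u (φ j) k) Filter.atTop (𝓝 (c k)) := fun k =>
    (tendsto_pi_nhds.1 hc) k
  have hcB : ∀ s : Finset ℤ, ∑ k ∈ s, (1 + |(k:ℝ)|) ^ 2 * ‖c k‖ ^ 2 ≤ B := by
    intro s
    refine le_of_tendsto (f := fun j => ∑ k ∈ s, (1 + |(k:ℝ)|) ^ 2 * ‖u (φ j) k‖ ^ 2) (x := Filter.atTop) ?_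
      (Filter.Eventually.of_forall fun j => h (φ j) s)
    refine tendsto_finsetSum _ fun k _ => ?_
    exact (((hck k).norm).pow 2).const_mul _
  have hd : ∀ j, ∀ s : Finset ℤ, ∑ k ∈ s, (1 + |(k:ℝ)|) ^ 2 * ‖u (φ j) k - c k‖ ^ 2 ≤ 4 * B := by
    intro j s
    calc _ ≤ ∑ k ∈ s, (2 * ((1 + |(k:ℝ)|) ^ 2 * ‖u (φ j) k‖ ^ 2) +
          2 * ((1 + |(k:ℝ)|) ^ 2 * ‖c k‖ ^ 2)) := by
          refine Finset.sum_le_sum fun k _ => ?_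
          have h1 : ‖u (φ j) k - c k‖ ^ 2 ≤ 2 * ‖u (φ j) k‖ ^ 2 + 2 * ‖c k‖ ^ 2 := by
            have := norm_sub_le (u (φ j) k) (c k)
            nlinarith [norm_nonneg (u (φ j) k - c k), sq_nonneg (‖u (φ j) k‖ - ‖c k‖)]
          nlinarith [sq_nonneg (1 + |(k:ℝ)|)]
      _ ≤ _ := by
          rw [Finset.sum_add_distrib, ← Finset.mul_sum, ← Finset.mul_sum]
          linarith [h (φ j) s, hcB s]
  refine ⟨c, φ, hφ, hck, ?_, ?_⟩
  · refine summable_of_sum_le (c := 1 * B + (∑' k : ℤ, 1 / (1 + |(k:ℝ)|) ^ 2) / 1) (fun k => norm_nonneg _) fun s => ?_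
    refine (young_w 1 one_pos c B s (hcB s)).trans ?_
    gcongr
    exact wsum.sum_le_tsum s fun k _ => by positivity
  · intro e he
    set e1 := e / (2 * (4 * B + 1)) with he1
    have he1p : 0 < e1 := by positivity
    have he2 : e1 * (4 * B + 1) = e / 2 := by rw [he1]; field_simp
    obtain ⟨F, hF⟩ := (summable_iff_vanishing_norm.1 wsum) (e1 ^ 2) (by positivity)
    have hfin : ∀ᶠ j in Filter.atTop, ∑ k ∈ F, ‖u (φ j) k - c k‖ < e / 2 := by
      have : Filter.Tendsto (fun j => ∑ k ∈ F, ‖u (φ j) k - c k‖) Filter.atTop (𝓝 (∑ k ∈ F, 0)) := by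
        refine tendsto_finsetSum _ fun k _ => ?_
        exact tendsto_iff_norm_sub_tendsto_zero.1 (hck k)
      rw [Finset.sum_const_zero] at this
      exact this.eventually_lt_const (by positivity)
    filter_upwards [hfin] with j hj s
    have h1 : ∑ k ∈ s, ‖u (φ j) k - c k‖ ≤ ∑ k ∈ F, ‖u (φ j) k - c k‖ +
        ∑ k ∈ s \ F, ‖u (φ j) k - c k‖ := by
      rw [← Finset.sum_union Finset.disjoint_sdiff]
      refine Finset.sum_le_sum_of_subset_of_nonneg ?_ fun _ _ _ => norm_nonneg _
      intro k hk
      simp [hk]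
    have h2 := young_w e1 he1p (fun k => u (φ j) k - c k) (4 * B) (s \ F) (hd j _)
    have h3 := hF (s \ F) Finset.sdiff_disjoint
    have h4 := (abs_le.1 (Real.norm_eq_abs _ ▸ h3.le)).2
    have h5 : (∑ k ∈ s \ F, 1 / (1 + |(k:ℝ)|) ^ 2) / e1 ≤ e1 := by
      rw [div_le_iff₀ he1p]; nlinarith
    nlinarith




theorem const_scalar (z : ℝ → ℂ) (hz : Continuous z) (hp : ∀ t, z (t + 1) = z t)
    (h : ∀ k : ℤ, k ≠ 0 → ∫ t in (0:ℝ)..1, ex (-k) t * z t = 0) (t : ℝ) :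
    z t = ∫ t in (0:ℝ)..1, z t := by
  have hper : Function.Periodic z 1 := hp
  let g : C(AddCircle (1:ℝ), ℂ) := ⟨hper.lift, by
    refine continuous_coinduced_dom.mpr ?_
    exact hz⟩
  have hg : ∀ s : ℝ, g (s : AddCircle (1:ℝ)) = z s := fun s => rfl
  have hco : ∀ m : ℤ, fourierCoeff g m = ∫ t in (0:ℝ)..1, ex m t * z t := by
    intro m
    rw [fourierCoeff_eq_intervalIntegral _ _ 0]
    simp only [div_one, one_smul, zero_add]
    refine intervalIntegral.integral_congr fun s _ => ?_
    simp only [hg, ex_eq_fourier, smul_eq_mul]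
  have hz0 : ∀ m : ℤ, m ≠ 0 → fourierCoeff g m = 0 := by
    intro m hm
    rw [hco]
    have := h (-m) (by simpa using hm)
    rwa [neg_neg] at this
  have hsum : Summable (fourierCoeff g) :=
    summable_of_ne_finset_zero (s := {0}) fun m hm => hz0 m (by simpa using hm)
  have h1 := has_pointwise_sum_fourier_series_of_summable hsum (t : AddCircle (1:ℝ))
  have h2 := h1.unique (hasSum_single 0 fun m hm => by rw [hz0 m hm, zero_smul])
  rw [hg, hco] at h2
  rw [h2]
  simp [ex_zero]

theorem const_of_co (z : ℝ → Esp n) (hz : Continuous z) (hp : ∀ t, z (t + 1) = z t)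
    (h : ∀ k : ℤ, k ≠ 0 → co z k = 0) (t : ℝ) : z t = z 0 := by
  ext j
  have key := const_scalar (fun t => z t j) (by fun_prop) (fun t => by rw [hp]) (by
    intro k hk
    have h1 := h k hk
    unfold co at h1
    have h2 := congrArg (EuclideanSpace.proj (𝕜 := ℂ) j) h1
    rw [← ContinuousLinearMap.intervalIntegral_comp_comm] at h2
    · simpa using h2
    · apply Continuous.intervalIntegrable; fun_prop)
  rw [key t, ← key 0]

theorem ex_deriv (k : ℤ) (t : ℝ) :
    HasDerivAt (ex k) (-(2 * Real.pi * k * Complex.I) * ex k t) t := by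
  have h1 : HasDerivAt (fun t : ℝ => (-(2 * Real.pi * k * t : ℝ) * Complex.I : ℂ))
      (-(2 * Real.pi * k * Complex.I)) t := by
    have h2 : HasDerivAt (fun t : ℝ => ((2 * Real.pi * k * t : ℝ) : ℂ)) ((2 * Real.pi * k * 1 : ℝ) : ℂ) t :=
      ((hasDerivAt_id t).const_mul (2 * Real.pi * k)).ofReal_comp
    have h3 := (h2.neg).mul_const Complex.I
    have h4 : (-(2 * Real.pi * k * Complex.I) : ℂ) = -((2 * Real.pi * k * 1 : ℝ) : ℂ) * Complex.I := by
      push_cast; ring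
    rw [h4]
    exact h3
  have := h1.cexp
  rw [mul_comm (-(2 * Real.pi * k * Complex.I) : ℂ)]
  exact this

/-- The ODE from the Fourier relations. -/
theorem ode_of_co (x g : ℝ → Esp n) (hx : Continuous x) (hg : Continuous g)
    (hxp : ∀ t, x (t + 1) = x t) (hgp : ∀ t, g (t + 1) = g t)
    (h : ∀ k : ℤ, (2 * Real.pi * k : ℝ) • co x k = co g k) (t : ℝ) :
    HasDerivAt x (-(Complex.I • g t)) t := by
  set f : ℝ → Esp n := fun t => -(Complex.I • g t) with hf
  have hfc : Continuous f := by rw [hf]; fun_prop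
  set y : ℝ → Esp n := fun t => ∫ s in (0:ℝ)..t, f s with hy
  have hyd : ∀ t, HasDerivAt y (f t) t := fun t =>
    intervalIntegral.integral_hasDerivAt_right (hfc.intervalIntegrable _ _)
      (hfc.stronglyMeasurableAtFilter _ _) hfc.continuousAt
  have hyc : Continuous y := continuous_iff_continuousAt.2 fun t => (hyd t).continuousAt
  have hcof : ∀ k, co f k = -(Complex.I • co g k) := by
    intro k
    unfold co
    rw [← intervalIntegral.integral_smul, ← intervalIntegral.integral_neg]
    refine intervalIntegral.integral_congr fun s _ => ?_
    simp only [hf, smul_neg, smul_comm Complex.I]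
  have hf1 : ∫ s in (0:ℝ)..1, f s = 0 := by
    have h0 := hcof 0
    rw [← h 0] at h0
    simpa [co, ex_zero] using h0
  have hfp : Function.Periodic f 1 := fun t => by simp [hf, hgp]
  have hyp : ∀ t, y (t + 1) = y t := by
    intro t
    simp only [hy]
    rw [← intervalIntegral.integral_add_adjacent_intervals (hfc.intervalIntegrable 0 t)
      (hfc.intervalIntegrable t (t + 1)), hfp.intervalIntegral_add_eq t 0, zero_add, hf1, add_zero]
  have hcoy : ∀ k : ℤ, k ≠ 0 → co y k = co x k := by
    intro k hk
    have hparts := intervalIntegral.integral_smul_deriv_eq_deriv_smul_of_hasDerivAt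
      (a := 0) (b := 1) (u := ex (-k)) (v := y) (v' := f)
      (u' := fun t => -(2 * Real.pi * (-k : ℤ) * Complex.I) * ex (-k) t)
      (ex_cont _).continuousOn hyc.continuousOn (fun s _ => ex_deriv (-k) s) (fun s _ => hyd s)
      (by apply Continuous.intervalIntegrable; fun_prop)
      (hfc.intervalIntegrable _ _)
    have hb : ex (-k) 1 • y 1 - ex (-k) 0 • y 0 = 0 := by
      have h1 := ex_per (-k) 0
      have h2 := hyp 0
      rw [zero_add] at h1 h2
      rw [h1, h2, sub_self]
    rw [hb, zero_sub] at hparts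
    simp_rw [mul_smul] at hparts
    rw [intervalIntegral.integral_smul] at hparts
    change co f k = -(_ • co y k) at hparts
    rw [hcof, ← h k] at hparts
    have hne : (2 * Real.pi * k * Complex.I : ℂ) ≠ 0 := by simp [hk, Real.pi_ne_zero]
    have h3 : (2 * Real.pi * k * Complex.I : ℂ) • co y k = (2 * Real.pi * k * Complex.I : ℂ) • co x k := by
      have h4 : (2 * Real.pi * k : ℝ) • co x k = (2 * Real.pi * k : ℂ) • co x k := by
        rw [← Complex.coe_smul]; push_cast; rfl
      rw [h4, smul_smul, neg_inj] at hparts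
      rw [mul_comm (2 * Real.pi * k : ℂ) Complex.I, hparts]
      congr 1
      push_cast; ring
    exact smul_right_injective _ hne h3
  have hz := const_of_co (fun t => x t - y t) (by fun_prop) (fun t => by simp [hxp, hyp]) (by
    intro k hk
    have : co (fun t => x t - y t) k = co x k - co y k := by
      unfold co
      rw [← intervalIntegral.integral_sub]
      · simp_rw [smul_sub]
      · apply Continuous.intervalIntegrable; fun_prop
      · apply Continuous.intervalIntegrable; fun_prop
    rw [this, hcoy k hk, sub_self])
  have hx2 : x = fun t => y t + (x 0 - y 0) := by
    funext s
    have := hz s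
    rw [← this]; abel
  rw [hx2]
  exact (hyd t).add_const _




theorem coV_norm_le (N : ℕ) (f : ℝ → Esp n) (hf : Continuous f) (M : ℝ) (hM : ∀ t, ‖f t‖ ≤ M) :
    ‖coV N f‖ ≤ M := by
  have hM0 : 0 ≤ M := (norm_nonneg _).trans (hM 0)
  have h1 : ‖coV N f‖ ^ 2 ≤ ∫ t in (0:ℝ)..1, (M ^ 2 / 2 + 1 / 2 * ‖tp (coV N f) t‖ ^ 2) := by
    rw [← real_inner_self_eq_norm_sq, inner_coV f hf]
    apply intervalIntegral.integral_mono_on zero_le_one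
    · apply Continuous.intervalIntegrable; fun_prop
    · apply Continuous.intervalIntegrable; fun_prop
    · intro t _
      have h2 := real_inner_le_norm (f t) (tp (coV N f) t)
      have h3 := hM t
      have h4 := norm_nonneg (f t)
      nlinarith [sq_nonneg (‖f t‖ - ‖tp (coV N f) t‖)]
  rw [intervalIntegral.integral_add (by apply Continuous.intervalIntegrable; fun_prop)
      (by apply Continuous.intervalIntegrable; fun_prop),
    intervalIntegral.integral_const_mul, parseval_sq] at h1
  simp at h1
  nlinarith [norm_nonneg (coV N f)]

theorem tp_smul {N : ℕ} (a : ℝ) (c : VV n N) (t : ℝ) : tp (a • c) t = a • tp c t := by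
  simp only [tp, PiLp.smul_apply, Finset.smul_sum]
  exact Finset.sum_congr rfl fun k _ => smul_comm _ _ _

theorem co_sub (f g : ℝ → Esp n) (hf : Continuous f) (hg : Continuous g) (k : ℤ) :
    co (fun t => f t - g t) k = co f k - co g k := by
  unfold co
  rw [← intervalIntegral.integral_sub]
  · simp_rw [smul_sub]
  · apply Continuous.intervalIntegrable; fun_prop
  · apply Continuous.intervalIntegrable; fun_prop

theorem int_w (k : ℤ) : (1 + |(k:ℝ)|) ^ 2 ≤ (2 * Real.pi * k - 3 * Real.pi) ^ 2 := by
  have h1 : 1 + |k| ≤ 3 * |2 * k - 3| := by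
    rcases abs_cases k with h | h <;> rcases abs_cases (2 * k - 3) with h' | h' <;> omega
  have h2 : (1 + |(k:ℝ)|) ≤ 3 * |2 * (k:ℝ) - 3| := by exact_mod_cast h1
  have h3 : (2 * Real.pi * k - 3 * Real.pi) ^ 2 = (Real.pi * |2 * (k:ℝ) - 3|) ^ 2 := by
    rw [mul_pow, sq_abs]; ring
  rw [h3]
  have h4 := Real.pi_gt_three
  have h5 := abs_nonneg (2 * (k:ℝ) - 3)
  have h6 := abs_nonneg (k:ℝ)
  apply pow_le_pow_left₀ (by positivity)
  nlinarith

theorem weighted_bound (N : ℕ) (G' : Esp n → Esp n) (hG' : Continuous G') (M : ℝ)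
    (hM : ∀ z, ‖G' z - (3 * Real.pi) • z‖ ≤ M) (c : VV n N) (hc : ‖gradN N G' c‖ ≤ 1) :
    ∑ k : Ix N, (1 + |((k:ℤ):ℝ)|) ^ 2 * ‖c k‖ ^ 2 ≤ (1 + M) ^ 2 := by
  set f : ℝ → Esp n := fun t => G' (tp c t) - (3 * Real.pi) • tp c t with hf
  have hfc : Continuous f := by rw [hf]; fun_prop
  set d : VV n N := gradN N G' c + coV N f with hd
  have hdn : ‖d‖ ≤ 1 + M := (norm_add_le _ _).trans (add_le_add hc (coV_norm_le N f hfc M fun t => hM _))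
  have hdk : ∀ k : Ix N, d k = (2 * Real.pi * (k:ℤ) - 3 * Real.pi : ℝ) • c k := by
    intro k
    have h1 : co f k = co (fun t => G' (tp c t)) k - (3 * Real.pi) • c k := by
      rw [hf, co_sub _ _ (by fun_prop) (by fun_prop)]
      congr 1
      have := co_tp ((3 * Real.pi) • c) k
      rw [show tp ((3 * Real.pi) • c) = fun t => (3 * Real.pi) • tp c t from
        funext fun t => tp_smul _ _ _] at this
      exact this
    rw [hd]
    simp only [gradN, coV, PiLp.add_apply, PiLp.sub_apply]
    rw [h1, sub_smul]
    abel
  calc _ ≤ ∑ k : Ix N, ‖d k‖ ^ 2 := by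
        refine Finset.sum_le_sum fun k _ => ?_
        rw [hdk, norm_smul, mul_pow, Real.norm_eq_abs, sq_abs]
        have := int_w k
        gcongr
    _ = ‖d‖ ^ 2 := (PiLp.norm_sq_eq_of_L2 _ _).symm
    _ ≤ _ := pow_le_pow_left₀ (norm_nonneg _) hdn 2

def extd {N : ℕ} (c : VV n N) (k : ℤ) : Esp n :=
  if h : k ∈ Finset.Icc (-(N:ℤ)) (N:ℤ) then c ⟨k, h⟩ else 0

theorem extd_coe {N : ℕ} (c : VV n N) (k : Ix N) : extd c k = c k := by
  unfold extd; rw [dif_pos k.2]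

theorem extd_out {N : ℕ} (c : VV n N) (k : ℤ) (h : k ∉ Finset.Icc (-(N:ℤ)) (N:ℤ)) : extd c k = 0 := by
  unfold extd; rw [dif_neg h]

theorem tp_hasSum {N : ℕ} (c : VV n N) (t : ℝ) :
    HasSum (fun k : ℤ => ex k t • extd c k) (tp c t) := by
  have h1 : tp c t = ∑ k ∈ Finset.Icc (-(N:ℤ)) (N:ℤ), ex k t • extd c k := by
    rw [← Finset.sum_coe_sort]
    unfold tp
    exact Finset.sum_congr rfl fun k _ => by rw [extd_coe]
  rw [h1]
  exact hasSum_sum_of_ne_finset_zero fun k hk => by rw [extd_out c k hk, smul_zero]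

theorem extd_bound {N : ℕ} (c : VV n N) (s : Finset ℤ) :
    ∑ k ∈ s, (1 + |(k:ℝ)|) ^ 2 * ‖extd c k‖ ^ 2 ≤
      ∑ k : Ix N, (1 + |((k:ℤ):ℝ)|) ^ 2 * ‖c k‖ ^ 2 := by
  have h1 : ∑ k : Ix N, (1 + |((k:ℤ):ℝ)|) ^ 2 * ‖c k‖ ^ 2 =
      ∑ k ∈ Finset.Icc (-(N:ℤ)) (N:ℤ), (1 + |(k:ℝ)|) ^ 2 * ‖extd c k‖ ^ 2 := by
    rw [← Finset.sum_coe_sort (Finset.Icc (-(N:ℤ)) (N:ℤ))]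
    exact Finset.sum_congr rfl fun k _ => by rw [extd_coe]
  rw [h1, ← Finset.sum_filter_add_sum_filter_not s (fun k => k ∈ Finset.Icc (-(N:ℤ)) (N:ℤ))]
  rw [Finset.sum_eq_zero (s := s.filter fun k => k ∉ Finset.Icc (-(N:ℤ)) (N:ℤ)) (f := fun k : ℤ => (1 + |(k:ℝ)|) ^ 2 * ‖extd c k‖ ^ 2)
    (fun k hk => by rw [extd_out c k (Finset.mem_filter.1 hk).2]; simp), add_zero]
  refine Finset.sum_le_sum_of_subset_of_nonneg ?_ fun _ _ _ => by positivity
  intro k hk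
  exact (Finset.mem_filter.1 hk).2

theorem phiN_eq (N : ℕ) (G : Esp n → ℝ) (G' : Esp n → Esp n) (hG : Continuous G)
    (hG' : Continuous G') (c : VV n N) :
    phiN N G c = 1 / 2 * ⟪gradN N G' c, c⟫ +
      ∫ t in (0:ℝ)..1, (1 / 2 * ⟪G' (tp c t), tp c t⟫ - G (tp c t)) := by
  unfold phiN gradN
  rw [intervalIntegral.integral_sub (by apply Continuous.intervalIntegrable; fun_prop)
    (by apply Continuous.intervalIntegrable; fun_prop), intervalIntegral.integral_const_mul,
    inner_sub_left, inner_coV _ (by fun_prop), PiLp.inner_apply]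
  have : ∑ k : Ix N, ⟪((2 * Real.pi * (k:ℤ) : ℝ) • c k : Esp n), c k⟫ =
      2 * ∑ k : Ix N, Real.pi * (k:ℤ) * ‖c k‖ ^ 2 := by
    rw [Finset.mul_sum]
    refine Finset.sum_congr rfl fun k _ => ?_
    rw [real_inner_smul_left, real_inner_self_eq_norm_sq]; ring
  rw [this]
  ring




theorem int_lim {E : Type*} [NormedAddCommGroup E] [NormedSpace ℝ E]
    (F : ℝ × Esp n → E) (hF : Continuous F)
    (xN : ℕ → ℝ → Esp n) (x : ℝ → Esp n) (B : ℝ) (hc : ∀ j, Continuous (xN j))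
    (hB : ∀ j t, ‖xN j t‖ ≤ B)
    (hlim : ∀ t, Filter.Tendsto (fun j => xN j t) Filter.atTop (𝓝 (x t))) :
    Filter.Tendsto (fun j => ∫ t in (0:ℝ)..1, F (t, xN j t)) Filter.atTop
      (𝓝 (∫ t in (0:ℝ)..1, F (t, x t))) := by
  obtain ⟨C, hC⟩ := ((isCompact_Icc (a := (0:ℝ)) (b := 1)).prod
    (isCompact_closedBall (0 : Esp n) B)).exists_bound_of_continuousOn hF.continuousOn
  refine intervalIntegral.tendsto_integral_filter_of_dominated_convergence (fun _ => C) ?_ ?_ ?_ ?_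
  · exact Filter.Eventually.of_forall fun j =>
      (hF.comp (continuous_id.prodMk (hc j))).aestronglyMeasurable
  · refine Filter.Eventually.of_forall fun j => Filter.Eventually.of_forall fun t ht => ?_
    rw [uIoc_of_le zero_le_one] at ht
    exact hC (t, xN j t) ⟨⟨ht.1.le, ht.2⟩, by simpa using hB j t⟩
  · simp
  · refine Filter.Eventually.of_forall fun t _ => ?_
    exact (hF.tendsto (t, x t)).comp (tendsto_const_nhds.prodMk_nhds (hlim t))

theorem limit_thm (G : Esp n → ℝ) (G' : Esp n → Esp n) (hG : Continuous G) (hG' : Continuous G')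
    (M : ℝ) (hM : ∀ z, ‖G' z - (3 * Real.pi) • z‖ ≤ M) (α β : ℝ)
    (h : ∀ N, 1 ≤ N → ∀ δ > 0, ∃ c : VV n N, α ≤ phiN N G c ∧ phiN N G c ≤ β ∧
      ‖gradN N G' c‖ < δ) :
    ∃ x : ℝ → Esp n, (∀ t, HasDerivAt x (-(Complex.I • G' (x t))) t) ∧ (∀ t, x (t + 1) = x t) ∧
      α ≤ ∫ t in (0:ℝ)..1, (1 / 2 * ⟪G' (x t), x t⟫ - G (x t)) ∧
      ∫ t in (0:ℝ)..1, (1 / 2 * ⟪G' (x t), x t⟫ - G (x t)) ≤ β := by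
  have h' : ∀ N : ℕ, ∃ c : VV n (N + 1), α ≤ phiN (N + 1) G c ∧ phiN (N + 1) G c ≤ β ∧
      ‖gradN (N + 1) G' c‖ < 1 / ((N : ℝ) + 1) :=
    fun N => h (N + 1) (by omega) _ (by positivity)
  choose cN hα hβ hgr using h'
  have hgr1 : ∀ N, ‖gradN (N + 1) G' (cN N)‖ ≤ 1 := fun N => (hgr N).le.trans (by
    rw [div_le_one (by positivity)]; linarith [Nat.cast_nonneg (α := ℝ) N])
  have hM0 : 0 ≤ M := (norm_nonneg _).trans (hM 0)
  have hW := fun N => weighted_bound (N + 1) G' hG' M hM (cN N) (hgr1 N)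
  have hU : ∀ N, ∀ s : Finset ℤ, ∑ k ∈ s, (1 + |(k:ℝ)|) ^ 2 * ‖extd (cN N) k‖ ^ 2 ≤ (1 + M) ^ 2 :=
    fun N s => (extd_bound (cN N) s).trans (hW N)
  obtain ⟨c, φ, hφ, hck, hcs, hce⟩ := seq_compact (fun N => extd (cN N)) _ hU
  have hsum : ∀ t, Summable (fun k : ℤ => ex k t • c k) := fun t => by
    refine Summable.of_norm ?_
    simpa [norm_smul, ex_norm] using hcs
  set x : ℝ → Esp n := fun t => ∑' k : ℤ, ex k t • c k with hx
  set xN : ℕ → ℝ → Esp n := fun j => tp (cN (φ j)) with hxN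
  have hxc : Continuous x := by
    refine continuous_tsum (fun k => by fun_prop) hcs fun k t => ?_
    rw [norm_smul, ex_norm, one_mul]
  have hxp : ∀ t, x (t + 1) = x t := fun t => by simp only [hx, ex_per]
  have hxNc : ∀ j, Continuous (xN j) := fun j => tp_cont _
  set B : ℝ := 1 * (1 + M) ^ 2 + (∑' k : ℤ, 1 / (1 + |(k:ℝ)|) ^ 2) / 1 with hB
  have hxNB : ∀ j t, ‖xN j t‖ ≤ B := by
    intro j t
    refine le_of_tendsto ((tp_hasSum (cN (φ j)) t).norm) (Filter.Eventually.of_forall fun s => ?_)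
    refine (norm_sum_le _ _).trans ?_
    simp only [norm_smul, ex_norm, one_mul]
    refine (young_w 1 one_pos _ _ s (hU (φ j) s)).trans ?_
    rw [hB]
    gcongr
    exact wsum.sum_le_tsum s fun k _ => by positivity
  have hlim : ∀ t, Filter.Tendsto (fun j => xN j t) Filter.atTop (𝓝 (x t)) := by
    intro t
    rw [Metric.tendsto_nhds]
    intro e he
    filter_upwards [hce (e / 2) (by positivity)] with j hj
    rw [dist_eq_norm]
    refine lt_of_le_of_lt ?_ (half_lt_self he)
    refine le_of_tendsto (((tp_hasSum (cN (φ j)) t).sub (hsum t).hasSum).norm)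
      (Filter.Eventually.of_forall fun s => ?_)
    refine le_trans ?_ (hj s)
    refine (norm_sum_le _ _).trans (le_of_eq ?_)
    refine Finset.sum_congr rfl fun k _ => ?_
    rw [← smul_sub, norm_smul, ex_norm, one_mul]
  have hco : ∀ (k : ℤ) (F : Esp n → Esp n), Continuous F →
      Filter.Tendsto (fun j => co (fun t => F (xN j t)) k) Filter.atTop
        (𝓝 (co (fun t => F (x t)) k)) := by
    intro k F hF
    exact int_lim (fun p => ex (-k) p.1 • F p.2) (by fun_prop) xN x B hxNc hxNB hlim
  have hgz : Filter.Tendsto (fun j => ‖gradN (φ j + 1) G' (cN (φ j))‖) Filter.atTop (𝓝 0) := by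
    refine squeeze_zero (fun _ => norm_nonneg _) (fun j => (hgr (φ j)).le) ?_
    exact tendsto_one_div_add_atTop_nhds_zero_nat.comp hφ.tendsto_atTop
  have heq : ∀ k : ℤ, (2 * Real.pi * k : ℝ) • co x k = co (fun t => G' (x t)) k := by
    intro k
    have h1 := (hco k id continuous_id).const_smul (2 * Real.pi * k : ℝ)
    have h2 := hco k G' hG'
    have h3 := h1.sub h2
    have h4 : Filter.Tendsto (fun j => (2 * Real.pi * k : ℝ) • co (fun t => id (xN j t)) k -
        co (fun t => G' (xN j t)) k) Filter.atTop (𝓝 0) := by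
      rw [tendsto_zero_iff_norm_tendsto_zero]
      refine squeeze_zero' (Filter.Eventually.of_forall fun _ => norm_nonneg _) ?_ hgz
      filter_upwards [Filter.eventually_ge_atTop k.natAbs] with j hj
      have hkm : k ∈ Finset.Icc (-((φ j + 1 : ℕ):ℤ)) ((φ j + 1 : ℕ):ℤ) := by
        have := hφ.id_le j
        simp only [id] at this
        rw [Finset.mem_Icc]
        omega
      have h5 := PiLp.norm_apply_le (gradN (φ j + 1) G' (cN (φ j))) ⟨k, hkm⟩
      refine le_trans (le_of_eq ?_) h5
      congr 1
      have h6 := co_tp (cN (φ j)) ⟨k, hkm⟩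
      simp only [gradN, coV, PiLp.sub_apply]
      rw [← h6]
      rfl
    have h5 := tendsto_nhds_unique h3 h4
    exact sub_eq_zero.1 h5
  refine ⟨x, fun t => ode_of_co x (fun t => G' (x t)) hxc (by fun_prop) hxp
    (fun t => by simp only [hxp]) heq t, hxp, ?_⟩
  have hval : Filter.Tendsto (fun j => phiN (φ j + 1) G (cN (φ j))) Filter.atTop
      (𝓝 (∫ t in (0:ℝ)..1, (1 / 2 * ⟪G' (x t), x t⟫ - G (x t)))) := by
    have h1 := int_lim (fun p : ℝ × Esp n => 1 / 2 * ⟪G' p.2, p.2⟫ - G p.2) (by fun_prop)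
      xN x B hxNc hxNB hlim
    have h2 : Filter.Tendsto (fun j => 1 / 2 * ⟪gradN (φ j + 1) G' (cN (φ j)), cN (φ j)⟫)
        Filter.atTop (𝓝 0) := by
      rw [tendsto_zero_iff_norm_tendsto_zero]
      have h3 : Filter.Tendsto (fun j => ‖gradN (φ j + 1) G' (cN (φ j))‖ * (1 + M)) Filter.atTop (𝓝 0) := by
        simpa using hgz.mul_const (1 + M)
      refine squeeze_zero (fun _ => norm_nonneg _) (fun j => ?_) h3
      have h4 := abs_real_inner_le_norm (gradN (φ j + 1) G' (cN (φ j))) (cN (φ j))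
      have h5 : ‖cN (φ j)‖ ≤ 1 + M := by
        refine abs_le_of_sq_le_sq' ?_ (by positivity) |>.2
        rw [PiLp.norm_sq_eq_of_L2]
        refine le_trans (Finset.sum_le_sum fun k _ => ?_) (hW (φ j))
        have h6 : (1:ℝ) ≤ (1 + |((k:ℤ):ℝ)|) ^ 2 := by
          have := abs_nonneg ((k:ℤ):ℝ); nlinarith
        nlinarith [sq_nonneg ‖cN (φ j) k‖]
      rw [Real.norm_eq_abs, abs_mul]
      have h7 := norm_nonneg (gradN (φ j + 1) G' (cN (φ j)))
      have h8 : |(1/2:ℝ)| = 1/2 := by norm_num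
      rw [h8]
      nlinarith [norm_nonneg (cN (φ j))]
    have h3 := h2.add h1
    rw [zero_add] at h3
    refine h3.congr fun j => ?_
    rw [phiN_eq _ G G' hG hG']
  exact ⟨ge_of_tendsto' hval fun j => hα _, le_of_tendsto' hval fun j => hβ _⟩




theorem sigma_ex (a δ c0 : ℝ) (ha : 0 ≤ a) (hδ : 0 < δ) (hc0 : 0 < c0) :
    ∃ (σ p : ℝ → ℝ) (d : ℝ), ContDiff ℝ (⊤ : ℕ∞) σ ∧ (∀ s, HasDerivAt σ (p s) s) ∧
      (∀ s, 0 ≤ p s) ∧ (∀ s, p s ≤ c0) ∧ (∀ s, s ≤ a → σ s = 0 ∧ p s = 0) ∧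
      (∀ s, a + δ ≤ s → p s = c0 ∧ σ s = c0 * s + d) ∧ (∀ s, 0 ≤ σ s) ∧
      (∀ s, 0 ≤ s → σ s ≤ c0 * s) ∧ (∀ s, c0 * (s - a - δ) ≤ σ s) := by
  set p : ℝ → ℝ := fun s => c0 * Real.smoothTransition ((s - a) / δ) with hp
  have hpc : ContDiff ℝ (⊤ : ℕ∞) p := by
    rw [hp]
    refine contDiff_const.mul (Real.smoothTransition.contDiff.comp ?_)
    fun_prop
  set σ : ℝ → ℝ := fun s => ∫ u in a..s, p u with hσ
  have hd : ∀ s, HasDerivAt σ (p s) s := fun s =>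
    intervalIntegral.integral_hasDerivAt_right (hpc.continuous.intervalIntegrable _ _)
      (hpc.continuous.stronglyMeasurableAtFilter _ _) hpc.continuous.continuousAt
  have hp0 : ∀ s, 0 ≤ p s := fun s => mul_nonneg hc0.le (Real.smoothTransition.nonneg _)
  have hp1 : ∀ s, p s ≤ c0 := fun s => by
    have := Real.smoothTransition.le_one ((s - a) / δ)
    simp only [hp]; nlinarith
  have hpa : ∀ s, s ≤ a → p s = 0 := fun s hs => by
    simp only [hp]
    rw [Real.smoothTransition.zero_of_nonpos, mul_zero]
    exact div_nonpos_of_nonpos_of_nonneg (by linarith) hδ.le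
  have hpb : ∀ s, a + δ ≤ s → p s = c0 := fun s hs => by
    simp only [hp]
    rw [Real.smoothTransition.one_of_one_le, mul_one]
    rw [le_div_iff₀ hδ]; linarith
  have hσd : Differentiable ℝ σ := fun s => (hd s).differentiableAt
  have hmono : Monotone σ := monotone_of_deriv_nonneg hσd fun s => by
    rw [(hd s).deriv]; exact hp0 s
  have hanti : Antitone (fun s => σ s - c0 * s) := by
    have h1 : ∀ s, HasDerivAt (fun s => σ s - c0 * s) (p s - c0 * 1) s := fun s =>
      (hd s).sub ((hasDerivAt_id s).const_mul c0)
    refine antitone_of_deriv_nonpos (fun s => (h1 s).differentiableAt) fun s => ?_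
    rw [(h1 s).deriv]; linarith [hp1 s]
  have hσa : σ a = 0 := by simp [hσ]
  have hσs : ∀ s, s ≤ a → σ s = 0 := by
    intro s hs
    simp only [hσ]
    rw [intervalIntegral.integral_congr (g := fun _ => (0:ℝ))]
    · simp
    · intro u hu
      rw [uIcc_of_ge hs] at hu
      exact hpa u hu.2
  have hσ0 : ∀ s, 0 ≤ σ s := by
    intro s
    rcases le_total s a with h | h
    · rw [hσs s h]
    · rw [← hσa]; exact hmono h
  have hσb : ∀ s, a + δ ≤ s → σ s = c0 * s + (σ (a + δ) - c0 * (a + δ)) := by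
    intro s hs
    have h1 : σ s = σ (a + δ) + ∫ u in (a + δ)..s, p u := by
      simp only [hσ]
      rw [intervalIntegral.integral_add_adjacent_intervals] <;>
      exact hpc.continuous.intervalIntegrable _ _
    have h2 : ∫ u in (a + δ)..s, p u = ∫ u in (a + δ)..s, c0 := by
      refine intervalIntegral.integral_congr fun u hu => ?_
      rw [uIcc_of_le hs] at hu
      exact hpb u hu.1
    rw [h1, h2, intervalIntegral.integral_const, smul_eq_mul]; ring
  refine ⟨σ, p, σ (a + δ) - c0 * (a + δ), ?_, hd, hp0, hp1, fun s hs => ⟨hσs s hs, hpa s hs⟩,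
    fun s hs => ⟨hpb s hs, hσb s hs⟩, hσ0, ?_, ?_⟩
  · rw [contDiff_infty_iff_deriv]
    refine ⟨hσd, ?_⟩
    rw [show deriv σ = p from funext fun s => (hd s).deriv]
    exact hpc
  · intro s hs
    have h1 := hanti hs
    simp only at h1
    rw [hσs 0 ha] at h1
    linarith
  · intro s
    rcases le_total s (a + δ) with h | h
    · have := hσ0 s
      nlinarith
    · rw [hσb s h]
      have := hσ0 (a + δ)
      linarith

/-- Second-order lower bound for a compactly supported smooth function. -/
theorem taylor_lower (k : Esp n → ℝ) (hk : ContDiff ℝ (⊤ : ℕ∞) k) (K : ℝ≥0)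
    (hL : LipschitzWith K (gradient k)) (z w : Esp n) :
    k z + ⟪gradient k z, w⟫ - K * ‖w‖ ^ 2 ≤ k (z + w) := by
  have hd : ∀ y, HasGradientAt k (gradient k y) y := fun y =>
    ((hk.differentiable (by simp)) y).hasGradientAt
  have h1 : ∀ s : ℝ, HasDerivAt (fun s : ℝ => k (z + s • w)) ⟪gradient k (z + s • w), w⟫ s := by
    intro s
    have h2 : HasDerivAt (fun s : ℝ => z + s • w) w s := by
      simpa using ((hasDerivAt_id s).smul_const w).const_add z
    have h3 := (hd (z + s • w)).hasFDerivAt.comp_hasDerivAt s h2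
    exact h3
  obtain ⟨θ, hθ, he⟩ := exists_hasDerivAt_eq_slope (fun s : ℝ => k (z + s • w))
    (fun s => ⟪gradient k (z + s • w), w⟫) zero_lt_one
    (fun s _ => (h1 s).continuousAt.continuousWithinAt) (fun s _ => h1 s)
  have he : ⟪gradient k (z + θ • w), w⟫ = k (z + w) - k z := by
    rw [he]; simp
  have h4 : ‖gradient k (z + θ • w) - gradient k z‖ ≤ K * ‖w‖ := by
    have h5 := hL.dist_le_mul (z + θ • w) z
    rw [dist_eq_norm, dist_eq_norm, add_sub_cancel_left, norm_smul, Real.norm_eq_abs,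
      abs_of_pos hθ.1] at h5
    refine h5.trans ?_
    gcongr
    nlinarith [norm_nonneg w, hθ.2]
  have h6 := abs_real_inner_le_norm (gradient k (z + θ • w) - gradient k z) w
  rw [inner_sub_left, he] at h6
  have h7 := (abs_le.1 h6).1
  nlinarith [norm_nonneg w]

theorem grad_lip (k : Esp n → ℝ) (hk : ContDiff ℝ (⊤ : ℕ∞) k) (hc : HasCompactSupport k) :
    (∃ K, LipschitzWith K (gradient k)) ∧ ∃ M, ∀ z, ‖gradient k z‖ ≤ M := by
  have h1 : ContDiff ℝ 1 (fderiv ℝ k) := (contDiff_infty.1 hk 2).fderiv_right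
    (m := 1) (by norm_num)
  have h2 : HasCompactSupport (fderiv ℝ k) := hc.fderiv ℝ
  constructor
  · obtain ⟨K, hK⟩ := h1.lipschitzWith_of_hasCompactSupport h2 (by simp)
    refine ⟨1 * K, ?_⟩
    exact ((InnerProductSpace.toDual ℝ (Esp n)).symm.lipschitz).comp hK
  · obtain ⟨M, hM⟩ := h2.exists_bound_of_continuous h1.continuous
    refine ⟨M, fun z => ?_⟩
    have := hM z
    unfold gradient
    rwa [LinearIsometryEquiv.norm_map]




theorem rot_sol (G' : Esp n → Esp n) (K : ℝ≥0) (hL : LipschitzWith K G') (x : ℝ → Esp n)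
    (hx : ∀ t, HasDerivAt x (-(Complex.I • G' (x t))) t) (hp : ∀ t, x (t + 1) = x t)
    (t0 q : ℝ) (hq : ∀ z : Esp n, ‖z‖ = ‖x t0‖ → G' z = (2 * q) • z) (h0 : x t0 ≠ 0) :
    (∀ t, ‖x t‖ = ‖x t0‖) ∧ ∃ m : ℤ, q = m * Real.pi := by
  set e : ℝ → ℂ := fun t => Complex.exp ((-(2 * q * (t - t0)) : ℝ) * Complex.I) with he
  have hen : ∀ t, ‖e t‖ = 1 := fun t => by simp only [he]; rw [Complex.norm_exp_ofReal_mul_I]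
  have hed : ∀ t, HasDerivAt e (e t * (-(2 * q) * Complex.I)) t := by
    intro t
    have h1 : HasDerivAt (fun t : ℝ => -(2 * q * (t - t0))) (-(2 * q * 1)) t :=
      (((hasDerivAt_id t).sub_const t0).const_mul (2 * q)).neg
    have h2 := (h1.ofReal_comp.mul_const Complex.I).cexp
    have h3 : (-(2 * q) * Complex.I : ℂ) = ((-(2 * q * 1) : ℝ) : ℂ) * Complex.I := by push_cast; ring
    rw [h3]
    exact h2
  have hxe : x = fun t => e t • x t0 := by
    refine ODE_solution_unique_univ (v := fun _ z => -(Complex.I • G' z)) (s := fun _ => univ)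
      (K := K) (t₀ := t0) ?_ (fun t => ⟨hx t, trivial⟩) (fun t => ⟨?_, trivial⟩) ?_
    · intro t
      refine LipschitzWith.lipschitzOnWith (LipschitzWith.of_dist_le_mul fun a b => ?_)
      have := hL.dist_le_mul a b
      rw [dist_neg_neg, dist_eq_norm, ← smul_sub, norm_smul, Complex.norm_I, one_mul, ← dist_eq_norm]
      exact this
    · rw [hq (e t • x t0) (by rw [norm_smul, hen, one_mul])]
      have h1 := (hed t).smul_const (x t0)
      have h2 : (-(Complex.I • (2 * q) • e t • x t0) : Esp n) =
          (e t * (-(2 * q) * Complex.I)) • x t0 := by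
        rw [← Complex.coe_smul (2 * q), smul_smul, smul_smul, ← neg_smul]
        congr 1
        push_cast; ring
      rw [h2]
      exact h1
    · simp [he]
  refine ⟨fun t => ?_, ?_⟩
  · rw [congrFun hxe t]
    simp only [norm_smul, hen, one_mul]
  · have h1 := congrFun hxe (t0 + 1)
    rw [hp t0] at h1
    have h2 : (e (t0 + 1) - 1) • x t0 = 0 := by rw [sub_smul, one_smul, ← h1, sub_self]
    have h3 : e (t0 + 1) = 1 := by
      rcases smul_eq_zero.1 h2 with h | h
      · exact sub_eq_zero.1 h
      · exact absurd h h0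
    simp only [he] at h3
    obtain ⟨m, hm⟩ := Complex.exp_eq_one_iff.1 h3
    refine ⟨-m, ?_⟩
    have h4 := congrArg Complex.im hm
    simp at h4
    push_cast
    linarith

theorem grad_sq (σ p : ℝ → ℝ) (hd : ∀ s, HasDerivAt σ (p s) s) (z : Esp n) :
    HasGradientAt (fun z : Esp n => σ (‖z‖ ^ 2)) ((2 * p (‖z‖ ^ 2)) • z) z := by
  rw [hasGradientAt_iff_hasFDerivAt]
  have h1 := (hasStrictFDerivAt_norm_sq z).hasFDerivAt
  have h2 := (hd (‖z‖ ^ 2)).comp_hasFDerivAt z h1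
  have h3 : (InnerProductSpace.toDual ℝ (Esp n)) ((2 * p (‖z‖ ^ 2)) • z) =
      p (‖z‖ ^ 2) • 2 • (innerSL ℝ) z := by
    ext w
    rw [InnerProductSpace.toDual_apply_apply, real_inner_smul_left]
    simp
    ring
  rw [h3]
  exact h2

theorem grad_zero_off (H : Esp n → ℝ) (z : Esp n) (hz : z ∉ tsupport H) : gradient H z = 0 := by
  have h1 : H =ᶠ[𝓝 z] fun _ => 0 := by
    filter_upwards [(isClosed_tsupport H).isOpen_compl.mem_nhds hz] with y hy
    exact image_eq_zero_of_notMem_tsupport hy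
  unfold gradient
  rw [h1.fderiv_eq]
  simp




set_option maxHeartbeats 2000000 in
theorem main_thm (n : ℕ) (hn : 1 ≤ n) (R : ℝ) (hR : 0 < R) (H : Esp n → ℝ)
    (hsm : ContDiff ℝ (⊤ : ℕ∞) H)
    (hsupp_cpt : IsCompact (tsupport H))
    (hsupp : tsupport H ⊆ ball (0 : Esp n) R)
    (hconst : ∀ᶠ x in 𝓝 (0 : Esp n), H x = H 0)
    (hmax : ∀ x, H x ≤ H 0)
    (hbig : Real.pi * R ^ 2 < H 0) :
    ∃ γ : ℝ → Esp n, (∀ t, HasDerivAt γ (hamVF H (γ t)) t) ∧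
      (∀ t, γ (t + 1) = γ t) ∧ (∃ t₀ t₁, γ t₀ ≠ γ t₁) ∧
      H 0 < action (fun _ => H) γ ∧
      action (fun _ => H) γ ≤ H 0 + Real.pi * R ^ 2 := by
  have hpi := Real.pi_pos
  set δ : ℝ := (H 0 - Real.pi * R ^ 2) / (2 * Real.pi) with hδ
  have hδ0 : 0 < δ := by
    rw [hδ]; apply div_pos <;> linarith
  have hδ1 : Real.pi * (R ^ 2 + δ) < H 0 := by
    have : Real.pi * δ = (H 0 - Real.pi * R ^ 2) / 2 := by rw [hδ]; field_simp
    nlinarith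
  obtain ⟨σ, p, d, hσs, hσd, hp0, hp1, hσa, hσb, hσ0, hσu, hσl⟩ :=
    sigma_ex (R ^ 2) δ (3 * Real.pi / 2) (by positivity) hδ0 (by positivity)
  have hHd : Differentiable ℝ H := hsm.differentiable (by simp)
  -- outside the ball
  have hoff : ∀ z : Esp n, R ≤ ‖z‖ → z ∉ tsupport H := by
    intro z hz hz'
    have := hsupp hz'
    rw [mem_ball, dist_zero_right] at this
    linarith
  have hH0 : ∀ z : Esp n, R ≤ ‖z‖ → H z = 0 := fun z hz =>
    image_eq_zero_of_notMem_tsupport (hoff z hz)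
  set k : Esp n → ℝ := fun z => -H z + (σ (‖z‖ ^ 2) - 3 * Real.pi / 2 * ‖z‖ ^ 2 - d) with hk
  have hks : ContDiff ℝ (⊤ : ℕ∞) k := by
    have h1 : ContDiff ℝ (⊤ : ℕ∞) (fun z : Esp n => ‖z‖ ^ 2) := contDiff_norm_sq ℝ
    exact hsm.neg.add (((hσs.comp h1).sub (contDiff_const.mul h1)).sub contDiff_const)
  have hkc : HasCompactSupport k := by
    refine HasCompactSupport.intro (isCompact_closedBall (0 : Esp n) (R + δ + 1)) fun z hz => ?_
    rw [mem_closedBall, dist_zero_right, not_le] at hz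
    have h1 : R ^ 2 + δ ≤ ‖z‖ ^ 2 := by nlinarith
    simp only [hk]
    rw [hH0 z (by linarith), (hσb _ h1).2]; ring
  have hkg : ∀ z, gradient k z = -gradient H z + (2 * (p (‖z‖ ^ 2) - 3 * Real.pi / 2)) • z := by
    intro z
    apply HasGradientAt.gradient
    have h1 := (hHd z).hasGradientAt
    have h2 := grad_sq (n := n) (fun s => σ s - 3 * Real.pi / 2 * s - d)
      (fun s => p s - 3 * Real.pi / 2) (fun s => by
        have := ((hσd s).sub ((hasDerivAt_id s).const_mul (3 * Real.pi / 2))).sub_const d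
        simpa using this) z
    rw [hasGradientAt_iff_hasFDerivAt] at h1 h2 ⊢
    rw [map_add, map_neg]
    exact h1.neg.add h2
  obtain ⟨⟨K, hK⟩, M, hM⟩ := grad_lip k hks hkc
  set G' : Esp n → Esp n := fun z => (3 * Real.pi) • z + gradient k z with hG'
  set G : Esp n → ℝ := fun z => H 0 - H z + σ (‖z‖ ^ 2) with hG
  have hG'eq : ∀ z, G' z = -gradient H z + (2 * p (‖z‖ ^ 2)) • z := by
    intro z
    simp only [hG']
    rw [hkg, mul_sub, sub_smul, show 2 * (3 * Real.pi / 2) = 3 * Real.pi by ring]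
    abel
  have hGk : ∀ z, G z = H 0 + d + 3 * Real.pi / 2 * ‖z‖ ^ 2 + k z := by
    intro z; simp only [hG, hk]; ring
  have hG'lip : LipschitzWith (‖(3 * Real.pi)‖₊ + K) G' :=
    (lipschitzWith_smul (3 * Real.pi)).add hK
  have hG'c : Continuous G' := hG'lip.continuous
  have hGc : Continuous G := by
    have := hσs.continuous
    have := hsm.continuous
    simp only [hG]; fun_prop
  have htay : ∀ z w, G z + ⟪G' z, w⟫ - K * ‖w‖ ^ 2 ≤ G (z + w) := by
    intro z w
    have h1 := taylor_lower k hks K hK z w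
    rw [hGk, hGk]
    simp only [hG']
    rw [inner_add_left, real_inner_smul_left, norm_add_sq_real]
    nlinarith [sq_nonneg ‖w‖]
  have hG0 : ∀ z, 0 ≤ G z := fun z => by
    have := hmax z; have := hσ0 (‖z‖ ^ 2); simp only [hG]; linarith
  -- small radius
  obtain ⟨r0, hr0, hr0'⟩ := Metric.eventually_nhds_iff.1 hconst
  set r : ℝ := min (r0 / 2) R with hr
  have hrp : 0 < r := lt_min (by positivity) hR
  have hGr : ∀ z, ‖z‖ ≤ r → G z = 0 := by
    intro z hz
    have h1 : ‖z‖ ≤ r0 / 2 := hz.trans (min_le_left _ _)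
    have h2 : ‖z‖ ≤ R := hz.trans (min_le_right _ _)
    have h3 : H z = H 0 := hr0' (by rw [dist_zero_right]; linarith)
    have h4 : ‖z‖ ^ 2 ≤ R ^ 2 := pow_le_pow_left₀ (norm_nonneg _) h2 2
    simp only [hG]
    rw [h3, (hσa _ h4).1]; ring
  obtain ⟨D, hD⟩ := (show HasCompactSupport H from hsupp_cpt).exists_bound_of_continuous hsm.continuous
  have hD0 : 0 ≤ D := (norm_nonneg _).trans (hD 0)
  set C : ℝ := 2 * D / r ^ 2 + 3 * Real.pi / 2 + 3 * Real.pi / 2 * (R ^ 2 + δ) with hC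
  have hC0 : 0 < C := by positivity
  have hGC : ∀ z, G z ≤ C * ‖z‖ ^ 2 := by
    intro z
    rcases le_total ‖z‖ r with h | h
    · rw [hGr z h]; positivity
    · have h1 : r ^ 2 ≤ ‖z‖ ^ 2 := pow_le_pow_left₀ hrp.le h 2
      have h2 := hσu (‖z‖ ^ 2) (by positivity)
      have h3 := (abs_le.1 (hD 0)).2
      have h4 := (abs_le.1 (hD z)).1
      have h5 : 2 * D ≤ 2 * D / r ^ 2 * ‖z‖ ^ 2 := by
        rw [div_mul_eq_mul_div, le_div_iff₀ (by positivity)]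
        nlinarith
      have h6 : 0 ≤ 3 * Real.pi / 2 * (R ^ 2 + δ) * ‖z‖ ^ 2 := by positivity
      simp only [hG, hC]
      nlinarith
  have hGR : ∀ z, Real.pi * ‖z‖ ^ 2 - Real.pi * R ^ 2 ≤ G z := by
    intro z
    rcases le_total ‖z‖ R with h | h
    · have h1 : ‖z‖ ^ 2 ≤ R ^ 2 := pow_le_pow_left₀ (norm_nonneg _) h 2
      have := hG0 z
      nlinarith
    · simp only [hG]
      rw [hH0 z h]
      have h2 := hσ0 (‖z‖ ^ 2)
      have h3 := hσl (‖z‖ ^ 2)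
      have h4 : 0 ≤ Real.pi * R ^ 2 := by positivity
      rcases le_total (‖z‖ ^ 2) (R ^ 2 + δ) with h5 | h5 <;> nlinarith
  have hGinf : ∀ z, 3 * Real.pi / 2 * ‖z‖ ^ 2 - C ≤ G z := by
    intro z
    have h1 := hσl (‖z‖ ^ 2)
    have h2 := hmax z
    have h3 : 0 ≤ 2 * D / r ^ 2 := by positivity
    simp only [hG, hC]
    nlinarith
  obtain ⟨α, hα, hgal⟩ := galerkin hn G G' hGc hG'c K K.2 htay C r R hC0 hrp hG0 hGr hGC hGR hGinf
  obtain ⟨x, hx, hxp, hva, hvb⟩ := limit_thm G G' hGc hG'c M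
    (fun z => by simp only [hG', add_sub_cancel_left]; exact hM z) α _ hgal
  have hxc : Continuous x := continuous_iff_continuousAt.2 fun t => (hx t).continuousAt
  -- the orbit stays in the ball
  have hin : ∀ t, ‖x t‖ < R := by
    intro t0
    by_contra hcon
    rw [not_lt] at hcon
    have hG'out : ∀ z : Esp n, R ≤ ‖z‖ → G' z = (2 * p (‖z‖ ^ 2)) • z := by
      intro z hz
      rw [hG'eq, grad_zero_off H z (hoff z hz), neg_zero, zero_add]
    obtain ⟨hnorm, m, hm⟩ := rot_sol G' _ hG'lip x hx hxp t0 (p (‖x t0‖ ^ 2))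
      (fun z hz => by rw [hG'out z (by rw [hz]; exact hcon), hz])
      (fun h0 => by rw [h0, norm_zero] at hcon; linarith)
    set s0 := ‖x t0‖ ^ 2 with hs0
    have hIntG : ∀ t, 1 / 2 * ⟪G' (x t), x t⟫ - G (x t) = p s0 * s0 - H 0 - σ s0 := by
      intro t
      have hRt : R ≤ ‖x t‖ := by rw [hnorm t]; exact hcon
      rw [hG'out _ hRt, real_inner_smul_left, real_inner_self_eq_norm_sq]
      simp only [hG]
      rw [hnorm t, ← hs0, hH0 _ hRt]; ring
    simp_rw [hIntG] at hva
    simp at hva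
    have hH0pos : 0 < H 0 := lt_of_le_of_lt (by positivity) hbig
    have h1 := hσ0 s0
    have hm0 : 0 ≤ m := by
      by_contra h
      have h2 : (m:ℝ) ≤ -1 := by exact_mod_cast (by omega : m ≤ -1)
      have := hp0 s0
      nlinarith
    have hm1 : m ≤ 1 := by
      by_contra h
      have h2 : (2:ℝ) ≤ m := by exact_mod_cast (by omega : 2 ≤ m)
      have := hp1 s0
      nlinarith
    have hm2 : m = 0 ∨ m = 1 := by omega
    rcases hm2 with h | h
    · rw [h] at hm
      simp at hm
      rw [hm] at hva
      linarith
    · rw [h] at hm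
      simp at hm
      have hs1 : s0 < R ^ 2 + δ := by
        by_contra hc
        rw [not_lt] at hc
        have := (hσb s0 hc).1
        linarith
      rw [hm] at hva
      nlinarith
  have hpin : ∀ t, ‖x t‖ ^ 2 ≤ R ^ 2 := fun t =>
    pow_le_pow_left₀ (norm_nonneg _) (hin t).le 2
  have hG'in : ∀ t, G' (x t) = -gradient H (x t) := by
    intro t
    rw [hG'eq, (hσa _ (hpin t)).2]; simp
  have hGin : ∀ t, G (x t) = H 0 - H (x t) := by
    intro t
    simp only [hG]
    rw [(hσa _ (hpin t)).1, add_zero]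
  have hact : action (fun _ => H) x = H 0 +
      ∫ t in (0:ℝ)..1, (1 / 2 * ⟪G' (x t), x t⟫ - G (x t)) := by
    unfold action
    have h1 : ∀ t, ⟪(Complex.I • x t : Esp n), deriv x t⟫ = -⟪G' (x t), x t⟫ := by
      intro t
      rw [(hx t).deriv, inner_neg_right, Esp.inner_I_smul, real_inner_comm]
    have hHc := hsm.continuous
    simp_rw [h1]
    rw [intervalIntegral.integral_sub (by apply Continuous.intervalIntegrable; fun_prop)
      (by apply Continuous.intervalIntegrable; fun_prop), intervalIntegral.integral_const_mul,
      intervalIntegral.integral_neg]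
    simp_rw [hGin]
    rw [intervalIntegral.integral_sub (by apply Continuous.intervalIntegrable; fun_prop)
      (by apply Continuous.intervalIntegrable; fun_prop)]
    simp
    ring
  refine ⟨x, ?_, hxp, ?_, ?_, ?_⟩
  · intro t
    have := hx t
    rw [hG'in, smul_neg, neg_neg] at this
    exact this
  · by_contra hne
    push Not at hne
    have h1 : ∀ t, G' (x t) = 0 := by
      intro t
      have h2 : x = fun _ => x 0 := funext fun s => hne s 0
      have h3 : HasDerivAt x 0 t := by rw [h2]; exact hasDerivAt_const _ _
      have h4 := (hx t).unique h3
      rw [neg_eq_zero, smul_eq_zero] at h4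
      exact h4.resolve_left Complex.I_ne_zero
    have h5 : ∫ t in (0:ℝ)..1, (1 / 2 * ⟪G' (x t), x t⟫ - G (x t)) ≤ ∫ t in (0:ℝ)..1, (0:ℝ) := by
      apply intervalIntegral.integral_mono_on zero_le_one
      · apply Continuous.intervalIntegrable; fun_prop
      · simp
      · intro t _
        rw [h1 t, inner_zero_left]
        linarith [hG0 (x t)]
    rw [intervalIntegral.integral_zero] at h5
    linarith
  · rw [hact]; linarith
  · rw [hact]; linarith


/-- **Theorem 5.1 of Ginzburg–Gürel for `W = ℝ^{2n}`, `M = {0}`, `U_R = B_R`**: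
if `H` is smooth with compact support in the ball `B_R`, constant near the
origin, attains its maximum at the origin, and `max H > π R²`, then the
Hamiltonian flow of `H` has a nonconstant `1`-periodic orbit with action in
`(max H, max H + π R²]`. -/
theorem stmt_1 (n : ℕ) (hn : 1 ≤ n) (R : ℝ) (hR : 0 < R) (H : Esp n → ℝ)
    (hsm : ContDiff ℝ (⊤ : ℕ∞) H)
    (hsupp_cpt : IsCompact (tsupport H))
    (hsupp : tsupport H ⊆ ball (0 : Esp n) R)
    (hconst : ∀ᶠ x in 𝓝 (0 : Esp n), H x = H 0)
    (hmax : ∀ x, H x ≤ H 0)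
    (hbig : Real.pi * R ^ 2 < H 0) :
    ∃ γ : ℝ → Esp n, (∀ t, HasDerivAt γ (hamVF H (γ t)) t) ∧
      (∀ t, γ (t + 1) = γ t) ∧ (∃ t₀ t₁, γ t₀ ≠ γ t₁) ∧
      H 0 < action (fun _ => H) γ ∧
      action (fun _ => H) γ ≤ H 0 + Real.pi * R ^ 2 := by
  exact main_thm n hn R hR H hsm hsupp_cpt hsupp hconst hmax hbig
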